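/- arXiv:2103.04021 — 5 statements merged into one kernel-verified Lean document; each statement's English description precedes it below -/
import Mathlib

section
/- Finite-time trajectory stability bound for the slow iterate (Theorem 1(ii)). Suppose the projected two-timescale SA iterates (λ_t, ξ_t) are driven by a Markov process with kernel 𝒦 started at w ∈ 𝒲, that (𝒦, ν, c₁, ρ) satisfies the U_d-geometric-ergodicity bound for d = 1 and for d = 2, that Assumption 2 holds, and that 1/2 < κ ≤ δ < 1. Fix arbitrary C > 0 and δ_c ∈ [0, δ − 1/2). Then there exist a constant C_ξ > 0 (depending on δ, δ_c, C, and w) and an integer T₀ such that for every integer T ≥ T₀: P( ‖ξ_t − ξ*‖ ≤ C·t^{−δ_c} for all t ≥ T ) ≥ 1 − C_ξ·T^{−(2δ−1−2δ_c)}·ln T. Moreover, if 𝒦(w') = ν for every w' ∈ 𝒲 (the i.i.d. case), the factor ln T can be removed from the bound. -/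
open MeasureTheory ProbabilityTheory Filter
open scoped RealInnerProductSpace

noncomputable section

/-- Euclidean state space. -/
abbrev Wsp (dW : ℕ) : Type := EuclideanSpace ℝ (Fin dW)

/-- `t`-step iterate of a Markov kernel. -/
noncomputable def kiter {α : Type*} [MeasurableSpace α] (K : Kernel α α) : ℕ → Kernel α α :=
  fun t => Nat.rec (motive := fun _ => Kernel α α) Kernel.id (fun _ ih => ih.comp K) t

instance kiter_isMarkovKernel {α : Type*} [MeasurableSpace α] (K : Kernel α α)
    [IsMarkovKernel K] (t : ℕ) : IsMarkovKernel (kiter K t) := by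
  induction t with
  | zero => exact inferInstanceAs (IsMarkovKernel (Kernel.id))
  | succ n ih => exact inferInstanceAs (IsMarkovKernel ((kiter K n).comp K))

/-- U_d geometric ergodicity bound. -/
def UdBound {dW : ℕ} (K : Kernel (Wsp dW) (Wsp dW)) [IsMarkovKernel K]
    (ν : Measure (Wsp dW)) [IsProbabilityMeasure ν] (c₁ ρ d : ℝ) : Prop :=
  Integrable (fun w' => (1 : ℝ) + ‖w'‖ ^ d) ν ∧
  ∀ (t : ℕ) (w : Wsp dW) (f : Wsp dW → ℝ), Measurable f →
    (∀ w', |f w'| ≤ 1 + ‖w'‖ ^ d) →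
      (∫ w', |f w'|
          ∂((((kiter K t) w).toSignedMeasure - ν.toSignedMeasure).totalVariation))
        ≤ c₁ * ρ ^ t * (1 + ‖w‖ ^ d)

/-- Markov process with kernel `K` started at `w`. -/
structure IsMarkovProc {dW : ℕ} {Ω : Type*} [MeasurableSpace Ω]
    (K : Kernel (Wsp dW) (Wsp dW)) (P : Measure Ω)
    (Wp : ℕ → Ω → Wsp dW) (w : Wsp dW) : Prop where
  meas : ∀ t, Measurable (Wp t)
  init : ∀ᵐ ω ∂P, Wp 0 ω = w
  markov : ∀ (t : ℕ) (f : Wsp dW → ℝ), Measurable f → (∃ C, ∀ x, |f x| ≤ C) →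
    (P[(fun ω => f (Wp (t+1) ω)) |
        ⨆ s ∈ Finset.range (t+1), MeasurableSpace.comap (Wp s) inferInstance])
      =ᵐ[P] fun ω => ∫ x, f x ∂(K (Wp t ω))

/-- Metric projection onto the closed ball of radius `B` centered at the origin. -/
def projB {E : Type*} [NormedAddCommGroup E] [NormedSpace ℝ E] (B : ℝ) (x : E) : E :=
  if ‖x‖ ≤ B then x else (B / ‖x‖) • x

/-- The slow (first-stage) SA iterates. -/
def xiSeq {dW dX : ℕ} {Ω : Type*}
    (H : Wsp dW → EuclideanSpace ℝ (Fin dX) → EuclideanSpace ℝ (Fin dX))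
    (β : ℕ → ℝ) (B : ℝ) (Wp : ℕ → Ω → Wsp dW) (xi0 : EuclideanSpace ℝ (Fin dX)) :
    ℕ → Ω → EuclideanSpace ℝ (Fin dX) :=
  fun t => Nat.rec (motive := fun _ => Ω → EuclideanSpace ℝ (Fin dX)) (fun _ => xi0)
    (fun s ih => fun ω => projB B (ih ω + β s • H (Wp s ω) (ih ω))) t

/-- The fast SA iterates. -/
def lamSeq {dW dL dX : ℕ} {Ω : Type*}
    (G : Wsp dW → EuclideanSpace ℝ (Fin dL) → EuclideanSpace ℝ (Fin dX) →
      EuclideanSpace ℝ (Fin dL))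
    (H : Wsp dW → EuclideanSpace ℝ (Fin dX) → EuclideanSpace ℝ (Fin dX))
    (α β : ℕ → ℝ) (B : ℝ) (Wp : ℕ → Ω → Wsp dW)
    (lam0 : EuclideanSpace ℝ (Fin dL)) (xi0 : EuclideanSpace ℝ (Fin dX)) :
    ℕ → Ω → EuclideanSpace ℝ (Fin dL) :=
  fun t => Nat.rec (motive := fun _ => Ω → EuclideanSpace ℝ (Fin dL)) (fun _ => lam0)
    (fun s ih => fun ω =>
      projB B (ih ω + α s • G (Wp s ω) (ih ω) (xiSeq H β B Wp xi0 s ω))) t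

/-- Assumption 2. -/
structure Assumption2 {dW dL dX : ℕ}
    (ν : Measure (Wsp dW))
    (G : Wsp dW → EuclideanSpace ℝ (Fin dL) → EuclideanSpace ℝ (Fin dX) →
      EuclideanSpace ℝ (Fin dL))
    (H : Wsp dW → EuclideanSpace ℝ (Fin dX) → EuclideanSpace ℝ (Fin dX))
    (lamStar : EuclideanSpace ℝ (Fin dL)) (xiStar : EuclideanSpace ℝ (Fin dX))
    (B L ζ ψ : ℝ) : Prop where
  hGmeas : Measurable fun p : Wsp dW × EuclideanSpace ℝ (Fin dL) × EuclideanSpace ℝ (Fin dX) =>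
    G p.1 p.2.1 p.2.2
  hHmeas : Measurable fun p : Wsp dW × EuclideanSpace ℝ (Fin dX) => H p.1 p.2
  hHstar : (∫ w', H w' xiStar ∂ν) = 0
  hHuniq : ∀ ξ, (∫ w', H w' ξ ∂ν) = 0 → ξ = xiStar
  hGstar : (∫ w', G w' lamStar xiStar ∂ν) = 0
  hGuniq : ∀ lam, (∫ w', G w' lam xiStar ∂ν) = 0 → lam = lamStar
  hB : max ‖lamStar‖ ‖xiStar‖ < B
  hL : 0 < L
  hGLip : ∀ (w' : Wsp dW) lam lam' ξ ξ', ‖lam‖ ≤ B → ‖lam'‖ ≤ B → ‖ξ‖ ≤ B → ‖ξ'‖ ≤ B →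
    ‖G w' lam ξ - G w' lam' ξ'‖ ≤ L * (1 + ‖w'‖) * (‖lam - lam'‖ + ‖ξ - ξ'‖)
  hHLip : ∀ (w' : Wsp dW) ξ ξ', ‖ξ‖ ≤ B → ‖ξ'‖ ≤ B →
    ‖H w' ξ - H w' ξ'‖ ≤ L * (1 + ‖w'‖) * ‖ξ - ξ'‖
  hGgrow : ∀ (w' : Wsp dW) lam ξ, ‖lam‖ ≤ B → ‖ξ‖ ≤ B → ‖G w' lam ξ‖ ≤ L * (1 + ‖w'‖)
  hHgrow : ∀ (w' : Wsp dW) ξ, ‖ξ‖ ≤ B → ‖H w' ξ‖ ≤ L * (1 + ‖w'‖)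
  hζ : 0 < ζ
  hGmono : ∀ lam, ⟪lam - lamStar,
      (∫ w', G w' lam xiStar ∂ν) - (∫ w', G w' lamStar xiStar ∂ν)⟫
      ≤ -ζ * ‖lam - lamStar‖ ^ 2
  hψ : 0 < ψ
  hHmono : ∀ ξ, ⟪ξ - xiStar, (∫ w', H w' ξ ∂ν) - (∫ w', H w' xiStar ∂ν)⟫
      ≤ -ψ * ‖ξ - xiStar‖ ^ 2



section TotalVariation

variable {α : Type*} [MeasurableSpace α] {μ ν : Measure α} [IsFiniteMeasure μ] [IsFiniteMeasure ν]
  {g : α → ℝ} {c : ℝ}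

/-- The Jordan decomposition of a difference of finite measures, written additively. -/
lemma add_negPart_sub_toSignedMeasure :
    μ + (μ.toSignedMeasure - ν.toSignedMeasure).toJordanDecomposition.negPart
      = ν + (μ.toSignedMeasure - ν.toSignedMeasure).toJordanDecomposition.posPart := by
  ext s hs
  have h := (μ.toSignedMeasure - ν.toSignedMeasure).apply_eq_posPart_real_sub_negPart_real hs
  rw [sub_apply, Measure.toSignedMeasure_apply_measurable hs,
    Measure.toSignedMeasure_apply_measurable hs] at h
  rw [← measureReal_eq_measureReal_iff, measureReal_add_apply, measureReal_add_apply]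
  linarith

/-- A bound on total-variation integrals of all measurable functions dominated by `g`
forces `g` itself to be integrable for the total variation. -/
lemma lintegral_totalVariation_le (hg : Measurable g) (hg0 : ∀ x, 0 ≤ g x)
    (τ : Measure α) [IsFiniteMeasure τ]
    (hc : ∀ f : α → ℝ, Measurable f → (∀ x, |f x| ≤ g x) → ∫ x, |f x| ∂τ ≤ c) :
    ∫⁻ x, ENNReal.ofReal (g x) ∂τ ≤ ENNReal.ofReal c := by
  have hlim : Tendsto (fun n : ℕ => ∫⁻ x, ENNReal.ofReal (min (g x) n) ∂τ) atTop
      (nhds (∫⁻ x, ENNReal.ofReal (g x) ∂τ)) := by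
    refine lintegral_tendsto_of_tendsto_of_monotone
      (fun n => (hg.min measurable_const).ennreal_ofReal.aemeasurable) ?_ ?_
    · refine ae_of_all _ fun x n m hnm => ENNReal.ofReal_le_ofReal ?_
      exact min_le_min le_rfl (by exact_mod_cast hnm)
    · refine ae_of_all _ fun x => tendsto_const_nhds.congr' ?_
      filter_upwards [eventually_ge_atTop ⌈g x⌉₊] with n hn
      rw [min_eq_left ((Nat.le_ceil _).trans (by exact_mod_cast hn))]
  refine le_of_tendsto' hlim fun n => ?_
  have hnn : ∀ x, 0 ≤ min (g x) (n : ℝ) := fun x => le_min (hg0 x) n.cast_nonneg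
  rw [← ofReal_integral_eq_lintegral_ofReal _ (ae_of_all _ hnn)]
  · refine ENNReal.ofReal_le_ofReal ?_
    have := hc (fun x => min (g x) n) (hg.min measurable_const)
      (fun x => by rw [abs_of_nonneg (hnn x)]; exact min_le_left _ _)
    simpa only [abs_of_nonneg (hnn _)] using this
  · refine Integrable.of_bound (hg.min measurable_const).aestronglyMeasurable (n : ℝ)
      (ae_of_all _ fun x => ?_)
    rw [Real.norm_of_nonneg (hnn x)]
    exact min_le_right _ _

/-- Functions dominated by a multiple of `g` are integrable, and their integrals against `μ` and
`ν` are close, once the total variation of `μ - ν` integrates `g`. -/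
lemma integrable_and_abs_integral_sub_le (hg : Measurable g) (hg0 : ∀ x, 0 ≤ g x)
    (hgν : Integrable g ν)
    (hc : ∀ f : α → ℝ, Measurable f → (∀ x, |f x| ≤ g x) →
      ∫ x, |f x| ∂(μ.toSignedMeasure - ν.toSignedMeasure).totalVariation ≤ c)
    {f : α → ℝ} (hf : Measurable f) {a : ℝ} (ha : 0 ≤ a) (hfg : ∀ x, |f x| ≤ a * g x) :
    Integrable f μ ∧ |∫ x, f x ∂μ - ∫ x, f x ∂ν| ≤ a * c := by
  have hc0 : 0 ≤ c := by simpa using hc (fun _ => 0) measurable_const (by simpa using hg0)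
  have hl := lintegral_totalVariation_le hg hg0 _ hc
  set σ := μ.toSignedMeasure - ν.toSignedMeasure
  have hJ : μ + σ.toJordanDecomposition.negPart = ν + σ.toJordanDecomposition.posPart :=
    add_negPart_sub_toSignedMeasure
  have hgσ : Integrable g σ.totalVariation := by
    refine ⟨hg.aestronglyMeasurable, ?_⟩
    rw [hasFiniteIntegral_iff_ofReal (ae_of_all _ hg0)]
    exact hl.trans_lt ENNReal.ofReal_lt_top
  have hgσc : ∫ x, g x ∂σ.totalVariation ≤ c := by
    rw [integral_eq_lintegral_of_nonneg_ae (ae_of_all _ hg0) hg.aestronglyMeasurable]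
    exact ENNReal.toReal_le_of_le_ofReal hc0 hl
  have hdom : ∀ m : Measure α, Integrable g m → Integrable f m := fun m hm =>
    (hm.const_mul a).mono' hf.aestronglyMeasurable (ae_of_all _ hfg)
  have hgJ : Integrable g σ.toJordanDecomposition.posPart ∧
      Integrable g σ.toJordanDecomposition.negPart := by
    rwa [SignedMeasure.totalVariation, integrable_add_measure] at hgσ
  have hgμ : Integrable g μ := by
    have : Integrable g (μ + σ.toJordanDecomposition.negPart) := by
      rw [hJ]; exact hgν.add_measure hgJ.1
    exact this.left_of_add_measure
  refine ⟨hdom _ hgμ, ?_⟩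
  have hint : ∫ x, f x ∂μ + ∫ x, f x ∂σ.toJordanDecomposition.negPart
      = ∫ x, f x ∂ν + ∫ x, f x ∂σ.toJordanDecomposition.posPart := by
    rw [← integral_add_measure (hdom _ hgμ) (hdom _ hgJ.2), hJ,
      integral_add_measure (hdom _ hgν) (hdom _ hgJ.1)]
  have hsum : ∫ x, |f x| ∂σ.totalVariation
      = ∫ x, |f x| ∂σ.toJordanDecomposition.posPart
        + ∫ x, |f x| ∂σ.toJordanDecomposition.negPart :=
    integral_add_measure (hdom _ hgJ.1).abs (hdom _ hgJ.2).abs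
  have hle : ∫ x, |f x| ∂σ.totalVariation ≤ a * c := by
    calc ∫ x, |f x| ∂σ.totalVariation ≤ ∫ x, a * g x ∂σ.totalVariation :=
          integral_mono (hdom _ hgσ).abs (hgσ.const_mul a) hfg
      _ = a * ∫ x, g x ∂σ.totalVariation := integral_const_mul _ _
      _ ≤ a * c := by gcongr
  have h1 := abs_integral_le_integral_abs (f := f) (μ := σ.toJordanDecomposition.posPart)
  have h2 := abs_integral_le_integral_abs (f := f) (μ := σ.toJordanDecomposition.negPart)
  rw [abs_le] at h1 h2 ⊢
  constructor <;> linarith [h1.1, h1.2, h2.1, h2.2]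

end TotalVariation

section KernelIterates

variable {α : Type*} [MeasurableSpace α]

lemma kiter_succ (K : Kernel α α) (t : ℕ) : kiter K (t + 1) = kiter K t ∘ₖ K := rfl

lemma kiter_succ' (K : Kernel α α) (t : ℕ) : kiter K (t + 1) = K ∘ₖ kiter K t := by
  induction t with
  | zero =>
    change Kernel.id ∘ₖ K = K ∘ₖ Kernel.id
    rw [Kernel.id_comp, Kernel.comp_id]
  | succ t ih => rw [kiter_succ, ih, Kernel.comp_assoc, ← kiter_succ, ih]

lemma kiter_one (K : Kernel α α) : kiter K 1 = K := Kernel.id_comp K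

end KernelIterates

section Ergodicity

variable {dW : ℕ} {K : Kernel (Wsp dW) (Wsp dW)} [IsMarkovKernel K]
  {ν : Measure (Wsp dW)} [IsProbabilityMeasure ν] {c₁ ρ d : ℝ}

lemma UdBound.integrable_and_abs_integral_sub_le (hU : UdBound K ν c₁ ρ d) (t : ℕ) (w : Wsp dW)
    {f : Wsp dW → ℝ} (hf : Measurable f) {a : ℝ} (ha : 0 ≤ a)
    (hfa : ∀ x, |f x| ≤ a * (1 + ‖x‖ ^ d)) :
    Integrable f (kiter K t w) ∧
      |∫ x, f x ∂(kiter K t w) - ∫ x, f x ∂ν| ≤ a * (c₁ * ρ ^ t * (1 + ‖w‖ ^ d)) :=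
  _root_.integrable_and_abs_integral_sub_le
    (measurable_const.add (measurable_norm.pow_const d))
    (fun x => add_nonneg zero_le_one (Real.rpow_nonneg (norm_nonneg x) d)) hU.1 (hU.2 t w) hf ha hfa

end Ergodicity

section MarkovProcess

variable {dW : ℕ} {Ω : Type*} [mΩ : MeasurableSpace Ω] {K : Kernel (Wsp dW) (Wsp dW)}
  {P : Measure Ω} {Wp : ℕ → Ω → Wsp dW} {w : Wsp dW}

/-- The filtration generated by a Markov process. -/
def IsMarkovProc.filtration (hMP : IsMarkovProc K P Wp w) : Filtration ℕ mΩ where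
  seq t := ⨆ s ∈ Finset.range (t + 1), MeasurableSpace.comap (Wp s) inferInstance
  mono' i j hij := biSup_mono fun s hs => by
    simp only [Finset.mem_range] at hs ⊢
    omega
  le' t := iSup₂_le fun s _ => (hMP.meas s).comap_le

lemma IsMarkovProc.measurable_filtration (hMP : IsMarkovProc K P Wp w) {s t : ℕ} (hst : s ≤ t) :
    Measurable[hMP.filtration t] (Wp s) := by
  have hle : MeasurableSpace.comap (Wp s) inferInstance ≤ hMP.filtration t :=
    le_iSup₂_of_le (f := fun s (_ : s ∈ Finset.range (t + 1)) =>
      MeasurableSpace.comap (Wp s) inferInstance) s (Finset.mem_range.2 (by omega)) le_rfl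
  exact (comap_measurable (Wp s)).mono hle le_rfl

variable [IsMarkovKernel K] [IsProbabilityMeasure P]

lemma IsMarkovProc.measure_inter_preimage (hMP : IsMarkovProc K P Wp w) (t : ℕ)
    {A : Set Ω}
    (hA : MeasurableSet[hMP.filtration t] A) {S : Set (Wsp dW)} (hS : MeasurableSet S) :
    P (A ∩ Wp (t + 1) ⁻¹' S) = ∫⁻ ω in A, K (Wp t ω) S ∂P := by
  have hA' : MeasurableSet A := hMP.filtration.le t A hA
  have hSpre : MeasurableSet (Wp (t + 1) ⁻¹' S) := hMP.meas (t + 1) hS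
  have hcond := hMP.markov t (S.indicator 1) (measurable_one.indicator hS)
    ⟨1, fun x => by by_cases hx : x ∈ S <;> simp [hx]⟩
  have hind : (fun ω => S.indicator (1 : Wsp dW → ℝ) (Wp (t + 1) ω))
      = (Wp (t + 1) ⁻¹' S).indicator 1 := rfl
  have hint : Integrable (fun ω => S.indicator (1 : Wsp dW → ℝ) (Wp (t + 1) ω)) P := by
    rw [hind]
    exact (integrable_const (1 : ℝ)).indicator hSpre
  have hset := setIntegral_condExp (hMP.filtration.le t) hint hA
  have hcond' : P[fun ω => S.indicator (1 : Wsp dW → ℝ) (Wp (t + 1) ω) | hMP.filtration t]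
      =ᵐ[P] fun ω => (K (Wp t ω)).real S :=
    hcond.trans (ae_of_all _ fun ω => by simp [integral_indicator_one hS])
  rw [setIntegral_congr_ae hA' (hcond'.mono fun ω h _ => h), hind,
    integral_indicator_one hSpre, measureReal_restrict_apply hSpre] at hset
  have hKm : Measurable fun ω => K (Wp t ω) S := (K.measurable_coe hS).comp (hMP.meas t)
  rw [Set.inter_comm, ← ENNReal.ofReal_toReal (measure_ne_top P (Wp (t + 1) ⁻¹' S ∩ A))]
  change ENNReal.ofReal (P.real _) = _
  rw [← hset, ofReal_integral_eq_lintegral_ofReal]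
  · exact lintegral_congr fun ω => ofReal_measureReal
  · refine Integrable.of_bound hKm.ennreal_toReal.aestronglyMeasurable 1 (ae_of_all _ fun ω => ?_)
    rw [Real.norm_of_nonneg measureReal_nonneg]
    exact measureReal_le_one
  · exact ae_of_all _ fun ω => measureReal_nonneg

lemma IsMarkovProc.map_eq_kiter (hMP : IsMarkovProc K P Wp w) (t : ℕ) :
    P.map (Wp t) = kiter K t w := by
  induction t with
  | zero =>
    rw [Measure.map_congr (g := fun _ => w) hMP.init, Measure.map_const]
    simp [kiter, Kernel.id_apply]
  | succ t ih =>
    ext S hS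
    have h := hMP.measure_inter_preimage t (A := Set.univ) MeasurableSet.univ hS
    rw [Set.univ_inter, Measure.restrict_univ] at h
    rw [Measure.map_apply (hMP.meas _) hS, h, kiter_succ', Kernel.comp_apply' _ _ _ hS, ← ih,
      lintegral_map (K.measurable_coe hS) (hMP.meas t)]

/-- Given the past up to time `t`, a past-measurable variable and the next state are jointly
distributed according to the kernel. -/
lemma IsMarkovProc.map_restrict_prod (hMP : IsMarkovProc K P Wp w) (t : ℕ) {A : Set Ω}
    (hA : MeasurableSet[hMP.filtration t] A) {E : Type*} [MeasurableSpace E] {Y : Ω → E}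
    (hY : Measurable[hMP.filtration t] Y) :
    (P.restrict A).map (fun ω => ((Y ω, Wp t ω), Wp (t + 1) ω))
      = (P.restrict A).map (fun ω => (Y ω, Wp t ω)) ⊗ₘ (K.prodMkLeft E) := by
  have hYW : Measurable[hMP.filtration t] fun ω => (Y ω, Wp t ω) :=
    hY.prodMk (hMP.measurable_filtration le_rfl)
  have hYW' : Measurable fun ω => (Y ω, Wp t ω) := hYW.mono (hMP.filtration.le t) le_rfl
  refine Measure.ext_prod fun {S S'} hS hS' => ?_
  have hA' : MeasurableSet A := hMP.filtration.le t A hA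
  have hSpre : MeasurableSet ((fun ω => (Y ω, Wp t ω)) ⁻¹' S) := hYW' hS
  rw [Measure.map_apply (hYW'.prodMk (hMP.meas _)) (hS.prod hS'),
    Measure.compProd_apply_prod hS hS', setLIntegral_map hS (Kernel.measurable_coe _ hS') hYW',
    Measure.restrict_restrict hSpre,
    Measure.restrict_apply ((hYW'.prodMk (hMP.meas _)) (hS.prod hS'))]
  simp only [Kernel.prodMkLeft_apply]
  rw [← hMP.measure_inter_preimage t ((hYW hS).inter hA) hS']
  congr 1
  ext ω
  simp only [Set.mem_inter_iff, Set.mem_preimage, Set.mem_prod]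
  tauto

/-- The Markov property for functions of the next state and a variable known at present. -/
lemma IsMarkovProc.integrableOn_and_setIntegral_succ (hMP : IsMarkovProc K P Wp w) (t : ℕ)
    {A : Set Ω} (hA : MeasurableSet[hMP.filtration t] A) {E : Type*} [MeasurableSpace E] {Y : Ω → E}
    (hY : Measurable[hMP.filtration t] Y) {u : Wsp dW → E → ℝ}
    (hu : Measurable (Function.uncurry u))
    (hint : Integrable (fun ω => u (Wp (t + 1) ω) (Y ω)) P) :
    IntegrableOn (fun ω => ∫ x, u x (Y ω) ∂(K (Wp t ω))) A P ∧
      ∫ ω in A, u (Wp (t + 1) ω) (Y ω) ∂P = ∫ ω in A, (∫ x, u x (Y ω) ∂(K (Wp t ω))) ∂P := by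
  have hY' : Measurable Y := hY.mono (hMP.filtration.le t) le_rfl
  have hYW : Measurable fun ω => (Y ω, Wp t ω) := hY'.prodMk (hMP.meas t)
  have hYWW : Measurable fun ω => ((Y ω, Wp t ω), Wp (t + 1) ω) := hYW.prodMk (hMP.meas _)
  let g : (E × Wsp dW) × Wsp dW → ℝ := fun p => u p.2 p.1.1
  have hg : Measurable g := hu.comp (measurable_snd.prodMk (measurable_fst.comp measurable_fst))
  have hgint : Integrable g
      ((P.restrict A).map (fun ω => (Y ω, Wp t ω)) ⊗ₘ (K.prodMkLeft E)) := by
    rw [← hMP.map_restrict_prod t hA hY,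
      integrable_map_measure hg.aestronglyMeasurable hYWW.aemeasurable]
    exact hint.integrableOn
  have hKm : StronglyMeasurable fun a : E × Wsp dW => ∫ x, u x a.1 ∂(K a.2) :=
    StronglyMeasurable.integral_kernel_prod_right' (κ := K.prodMkLeft E) hg.stronglyMeasurable
  refine ⟨(integrable_map_measure hKm.aestronglyMeasurable hYW.aemeasurable).1
    (Integrable.integral_compProd (κ := Kernel.const Unit _)
      (η := Kernel.prodMkLeft Unit (K.prodMkLeft E)) (a := ()) hgint), ?_⟩
  calc ∫ ω in A, u (Wp (t + 1) ω) (Y ω) ∂P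
      = ∫ p, g p ∂((P.restrict A).map (fun ω => ((Y ω, Wp t ω), Wp (t + 1) ω))) :=
        (integral_map hYWW.aemeasurable hg.aestronglyMeasurable).symm
    _ = ∫ a, ∫ x, u x a.1 ∂(K a.2) ∂((P.restrict A).map (fun ω => (Y ω, Wp t ω))) := by
        rw [hMP.map_restrict_prod t hA hY, Measure.integral_compProd hgint]
        rfl
    _ = ∫ ω in A, (∫ x, u x (Y ω) ∂(K (Wp t ω))) ∂P :=
        integral_map hYW.aemeasurable hKm.aestronglyMeasurable

/-- Second moments along the process are uniformly bounded. -/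
lemma IsMarkovProc.exists_moment_bound (hMP : IsMarkovProc K P Wp w)
    {ν : Measure (Wsp dW)} [IsProbabilityMeasure ν] {c₁ ρ : ℝ} (hc₁ : 0 < c₁) (hρ₀ : 0 ≤ ρ)
    (hρ₁ : ρ < 1) (hU : UdBound K ν c₁ ρ 2) :
    ∃ M : ℝ, ∀ t, Integrable (fun ω => (1 + ‖Wp t ω‖) ^ 2) P ∧
      ∫ ω, (1 + ‖Wp t ω‖) ^ 2 ∂P ≤ M := by
  have hf : Measurable fun x : Wsp dW => (1 + ‖x‖) ^ 2 := by fun_prop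
  refine ⟨∫ x, (1 + ‖x‖) ^ 2 ∂ν + 2 * (c₁ * (1 + ‖w‖ ^ (2 : ℝ))), fun t => ?_⟩
  obtain ⟨hi, hb⟩ := hU.integrable_and_abs_integral_sub_le t w hf zero_le_two fun x => by
    rw [abs_of_nonneg (by positivity), Real.rpow_two]
    nlinarith [sq_nonneg (‖x‖ - 1)]
  rw [← hMP.map_eq_kiter] at hi hb
  rw [integral_map (hMP.meas t).aemeasurable hf.aestronglyMeasurable] at hb
  refine ⟨(integrable_map_measure hf.aestronglyMeasurable (hMP.meas t).aemeasurable).1 hi, ?_⟩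
  have hρt : ρ ^ t ≤ 1 := pow_le_one₀ hρ₀ hρ₁.le
  have hle : c₁ * ρ ^ t * (1 + ‖w‖ ^ (2 : ℝ)) ≤ c₁ * (1 + ‖w‖ ^ (2 : ℝ)) := by
    have : 0 ≤ 1 + ‖w‖ ^ (2 : ℝ) := by positivity
    nlinarith [mul_nonneg hc₁.le this]
  linarith [(abs_le.1 hb).2]

end MarkovProcess

section Poisson

variable {dW : ℕ} {K : Kernel (Wsp dW) (Wsp dW)} [IsMarkovKernel K]
  {ν : Measure (Wsp dW)} [IsProbabilityMeasure ν] {c₁ ρ : ℝ}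

lemma UdBound.abs_integral_kiter_sub_le (hU : UdBound K ν c₁ ρ 1) (t : ℕ) (w : Wsp dW)
    {f : Wsp dW → ℝ} (hf : Measurable f) {a : ℝ} (ha : 0 ≤ a)
    (hfa : ∀ x, |f x| ≤ a * (1 + ‖x‖)) :
    Integrable f (kiter K t w) ∧
      |∫ x, f x ∂(kiter K t w) - ∫ x, f x ∂ν| ≤ a * c₁ * (1 + ‖w‖) * ρ ^ t := by
  obtain ⟨h1, h2⟩ := hU.integrable_and_abs_integral_sub_le t w hf ha
    (fun x => by simpa only [Real.rpow_one] using hfa x)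
  rw [Real.rpow_one] at h2
  exact ⟨h1, h2.trans_eq (by ring)⟩

/-- Solution of the Poisson equation `u - K u = φ` for a parametrised family of centred functions
of linear growth. -/
lemma UdBound.exists_poisson (hU : UdBound K ν c₁ ρ 1) (hρ₀ : 0 ≤ ρ) (hρ₁ : ρ < 1)
    {E : Type*} [MeasurableSpace E] {φ : Wsp dW → E → ℝ} (hφ : Measurable (Function.uncurry φ))
    (hb : ∀ x, ∃ a, 0 ≤ a ∧ ∀ w, |φ w x| ≤ a * (1 + ‖w‖))
    (h0 : ∀ x, ∫ w, φ w x ∂ν = 0) :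
    ∃ u : Wsp dW → E → ℝ, Measurable (Function.uncurry u) ∧
      (∀ w x, u w x - ∫ y, u y x ∂(K w) = φ w x) ∧
      (∀ x a, 0 ≤ a → (∀ w, |φ w x| ≤ a * (1 + ‖w‖)) →
        ∀ w, |u w x| ≤ c₁ / (1 - ρ) * a * (1 + ‖w‖)) ∧
      (∀ x y a, 0 ≤ a → (∀ w, |φ w x - φ w y| ≤ a * (1 + ‖w‖)) →
        ∀ w, |u w x - u w y| ≤ c₁ / (1 - ρ) * a * (1 + ‖w‖)) := by
  have hφx : ∀ x, Measurable fun w => φ w x := fun x => hφ.comp measurable_prodMk_right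
  let p : ℕ → Wsp dW → E → ℝ := fun k w x => ∫ y, φ y x ∂(kiter K k w)
  have hp : ∀ x a, 0 ≤ a → (∀ w, |φ w x| ≤ a * (1 + ‖w‖)) →
      ∀ k w, |p k w x| ≤ a * c₁ * (1 + ‖w‖) * ρ ^ k := fun x a ha hxa k w => by
    have := (hU.abs_integral_kiter_sub_le k w (hφx x) ha hxa).2
    rwa [h0, sub_zero] at this
  have hpm : ∀ k, Measurable (Function.uncurry (p k)) := fun k =>
    (StronglyMeasurable.integral_kernel_prod_right' (κ := (kiter K k).prodMkRight E)
      (f := fun q : (Wsp dW × E) × Wsp dW => φ q.2 q.1.2)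
      (hφ.comp (measurable_snd.prodMk
        (measurable_snd.comp measurable_fst))).stronglyMeasurable).measurable
  have hgeo : ∀ c : ℝ, HasSum (fun k => c * ρ ^ k) (c * (1 - ρ)⁻¹) := fun c =>
    (hasSum_geometric_of_lt_one hρ₀ hρ₁).mul_left c
  have hsum : ∀ w x, Summable fun k => p k w x := fun w x => by
    obtain ⟨a, ha, hxa⟩ := hb x
    exact Summable.of_norm_bounded (hgeo (a * c₁ * (1 + ‖w‖))).summable fun k => hp x a ha hxa k w
  refine ⟨fun w x => ∑' k, p k w x, ?_, ?_, ?_, ?_⟩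
  · refine measurable_of_tendsto_metrizable
      (f := fun n q => ∑ k ∈ Finset.range n, Function.uncurry (p k) q)
      (fun n => Finset.measurable_fun_sum _ fun k _ => hpm k) ?_
    exact tendsto_pi_nhds.2 fun q => (hsum q.1 q.2).hasSum.tendsto_sum_nat
  · intro w x
    obtain ⟨a, ha, hxa⟩ := hb x
    have hpx : ∀ k, Measurable fun w => p k w x := fun k =>
      (hpm k).comp measurable_prodMk_right
    have hgK : Integrable (fun y : Wsp dW => 1 + ‖y‖) (K w) := by
      have := (hU.abs_integral_kiter_sub_le 1 w (f := fun y => 1 + ‖y‖) (by fun_prop) zero_le_one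
        fun y => by rw [one_mul, abs_of_nonneg (by positivity)]).1
      rwa [kiter_one] at this
    have hpK : ∀ k, Integrable (fun y => p k y x) (K w) := fun k =>
      ((hgK.const_mul (a * c₁)).mul_const (ρ ^ k)).mono' (hpx k).aestronglyMeasurable
        (ae_of_all _ fun y => hp x a ha hxa k y)
    have hnorm : Summable fun k => ∫ y, ‖p k y x‖ ∂(K w) := by
      refine Summable.of_nonneg_of_le (fun k => integral_nonneg fun y => norm_nonneg _)
        (fun k => ?_) (hgeo (a * c₁ * ∫ y, (1 + ‖y‖) ∂(K w))).summable
      rw [← integral_const_mul, ← integral_mul_const]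
      exact integral_mono (hpK k).norm ((hgK.const_mul (a * c₁)).mul_const (ρ ^ k))
        fun y => hp x a ha hxa k y
    have hstep : ∀ k, ∫ y, p k y x ∂(K w) = p (k + 1) w x := fun k => by
      have hi := (hU.abs_integral_kiter_sub_le (k + 1) w (hφx x) ha hxa).1
      simp only [p]
      rw [kiter_succ] at hi ⊢
      exact (Kernel.integral_comp hi).symm
    have hp0 : p 0 w x = φ w x := by
      change ∫ y, φ y x ∂(Kernel.id w) = _
      rw [Kernel.id_apply, integral_dirac' _ _ (hφx x).stronglyMeasurable]
    beta_reduce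
    rw [← integral_tsum_of_summable_integral_norm hpK hnorm, (hsum w x).tsum_eq_zero_add, hp0]
    simp only [hstep]
    ring
  · intro x a ha hxa w
    change ‖∑' k, p k w x‖ ≤ _
    refine (tsum_of_norm_bounded (hgeo (a * c₁ * (1 + ‖w‖))) fun k => hp x a ha hxa k w).trans_eq ?_
    ring
  · intro x y a ha hxy w
    rw [← (hsum w x).tsum_sub (hsum w y)]
    obtain ⟨b, hb0, hbx⟩ := hb x
    obtain ⟨c, hc0, hcy⟩ := hb y
    have hk : ∀ k, ‖p k w x - p k w y‖ ≤ a * c₁ * (1 + ‖w‖) * ρ ^ k := fun k => by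
      have hν : ∀ z, Integrable (fun w => φ w z) ν := fun z => by
        obtain ⟨b, hb0, hbz⟩ := hb z
        exact (hU.1.const_mul b).mono' (hφx z).aestronglyMeasurable
          (ae_of_all _ fun w => by simpa only [Real.rpow_one, Real.norm_eq_abs] using hbz w)
      have h := (hU.abs_integral_kiter_sub_le k w ((hφx x).sub (hφx y)) ha hxy).2
      simp only [Pi.sub_apply] at h
      rw [integral_sub (hν x) (hν y), h0, h0, sub_zero, sub_zero,
        integral_sub (hU.abs_integral_kiter_sub_le k w (hφx x) hb0 hbx).1
          (hU.abs_integral_kiter_sub_le k w (hφx y) hc0 hcy).1] at h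
      exact h
    refine (tsum_of_norm_bounded (hgeo (a * c₁ * (1 + ‖w‖))) hk).trans_eq ?_
    ring

end Poisson

section Maximal

/-- A nonnegative process dominated by an initial value plus martingale increments plus nonnegative
increments satisfies the mean and maximal bounds coming from Doob's inequality. -/
lemma integral_le_and_maximal_le {Ω : Type*} [mΩ : MeasurableSpace Ω] {P : Measure Ω}
    [IsProbabilityMeasure P] {ℱ : Filtration ℕ mΩ} {q : Ω → ℝ} {N D v : ℕ → Ω → ℝ}
    (hqm : Measurable[ℱ 0] q) (hqi : Integrable q P)
    (hNm : ∀ k, Measurable[ℱ (k + 1)] (N k)) (hNi : ∀ k, Integrable (N k) P)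
    (hN : ∀ k A, MeasurableSet[ℱ k] A → ∫ ω in A, N k ω ∂P = 0)
    (hDm : ∀ k, Measurable[ℱ (k + 1)] (D k)) (hDi : ∀ k, Integrable (D k) P)
    (hD : ∀ k ω, 0 ≤ D k ω) (hv0 : ∀ k ω, 0 ≤ v k ω)
    (hv : ∀ k ω, v k ω ≤ q ω + ∑ j ∈ Finset.range k, (N j ω + D j ω)) (n : ℕ) :
    ∫ ω, v n ω ∂P ≤ ∫ ω, q ω ∂P + ∑ j ∈ Finset.range n, ∫ ω, D j ω ∂P ∧
    ∀ ε : ℝ, 0 < ε → P {ω | ∃ k ≤ n, ε ≤ v k ω} ≤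
      ENNReal.ofReal ((∫ ω, q ω ∂P + ∑ j ∈ Finset.range n, ∫ ω, D j ω ∂P) / ε) := by
  let Z : ℕ → Ω → ℝ := fun k ω => q ω + ∑ j ∈ Finset.range k, (N j ω + D j ω)
  have hNDi : ∀ k, Integrable (fun ω => N k ω + D k ω) P := fun k => (hNi k).add (hDi k)
  have hSi : ∀ k, Integrable (fun ω => ∑ j ∈ Finset.range k, (N j ω + D j ω)) P := fun k =>
    integrable_finsetSum _ fun j _ => hNDi j
  have hZi : ∀ k, Integrable (Z k) P := fun k =>
    hqi.add (hSi k)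
  have hZm : ∀ k, Measurable[ℱ k] (Z k) := fun k => by
    refine (hqm.mono (ℱ.mono (Nat.zero_le k)) le_rfl).add
      (Finset.measurable_fun_sum _ fun j hj => ?_)
    have hjk : j + 1 ≤ k := Finset.mem_range.1 hj
    exact ((hNm j).mono (ℱ.mono hjk) le_rfl).add ((hDm j).mono (ℱ.mono hjk) le_rfl)
  have hZ0 : 0 ≤ Z := fun k ω => (hv0 k ω).trans (hv k ω)
  have hZint : ∫ ω, Z n ω ∂P = ∫ ω, q ω ∂P + ∑ j ∈ Finset.range n, ∫ ω, D j ω ∂P := by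
    simp only [Z]
    rw [integral_add hqi (hSi n), integral_finsetSum _ fun j _ => hNDi j]
    congr 1
    refine Finset.sum_congr rfl fun j _ => ?_
    have h0 := hN j Set.univ MeasurableSet.univ
    rw [Measure.restrict_univ] at h0
    rw [integral_add (hNi j) (hDi j), h0, zero_add]
  have hsub : Submartingale Z ℱ P := by
    refine submartingale_of_setIntegral_le_succ (fun k => (hZm k).stronglyMeasurable) hZi
      fun k A hA => ?_
    have hsucc : ∀ ω, Z (k + 1) ω = Z k ω + (N k ω + D k ω) := fun ω => by
      simp only [Z, Finset.sum_range_succ]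
      ring
    simp only [hsucc]
    rw [integral_add (hZi k).integrableOn (hNDi k).integrableOn,
      integral_add (hNi k).integrableOn (hDi k).integrableOn, hN k A hA, zero_add]
    exact le_add_of_nonneg_right (integral_nonneg fun ω => hD k ω)
  rw [← hZint]
  refine ⟨integral_mono_of_nonneg (ae_of_all _ (hv0 n)) (hZi n) (ae_of_all _ (hv n)),
    fun ε hε => ?_⟩
  have hdoob := maximal_ineq hsub hZ0 (ε := ε.toNNReal) n
  set S : Set Ω := {ω | (ε.toNNReal : ℝ) ≤
    (Finset.range (n + 1)).sup' Finset.nonempty_range_add_one fun k => Z k ω} with hS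
  have hsubset : {ω | ∃ k ≤ n, ε ≤ v k ω} ⊆ S := by
    rintro ω ⟨k, hk, hkε⟩
    simp only [hS, Set.mem_ofPred_eq, Real.coe_toNNReal ε hε.le]
    exact (hkε.trans (hv k ω)).trans (Finset.le_sup' (fun k => Z k ω)
      (Finset.mem_range.2 (Nat.lt_succ_of_le hk)))
  have hle : ENNReal.ofReal ε * P S ≤ ENNReal.ofReal (∫ ω, Z n ω ∂P) :=
    hdoob.trans (ENNReal.ofReal_le_ofReal
      (setIntegral_le_integral (hZi n) (ae_of_all _ (hZ0 n))))
  rw [ENNReal.ofReal_div_of_pos hε,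
    ENNReal.le_div_iff_mul_le (Or.inl (by simpa using hε)) (Or.inl ENNReal.ofReal_ne_top), mul_comm]
  exact (mul_le_mul_right (measure_mono hsubset) _).trans hle

end Maximal

section Weights

/-- One step of the weighted Lyapunov recursion after summation by parts of the Poisson term. -/
lemma weighted_step {V V' β a a' b b' φ u u' û k L ψ cu D y y' c : ℝ}
    (hV : 0 ≤ V) (hβ : 0 ≤ β) (ha' : 0 ≤ a') (hb : b = 2 * a' * β) (hbb : b' ≤ b)
    (haa : a' * (1 - 2 * ψ * β) ≤ a) (hL : 0 ≤ L) (hcu : 0 ≤ cu) (hD : 0 ≤ D)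
    (hy' : 1 ≤ y')
    (hstep : V' ≤ (1 - 2 * ψ * β) * V + 2 * β * φ + β ^ 2 * L ^ 2 * y ^ 2)
    (hφ : φ = u - k) (hu' : |u'| ≤ cu * D * y') (hû : |u' - û| ≤ cu * (β * L * y) * y')
    (hc : cu * D + cu * L + L ^ 2 ≤ c) :
    a' * V' + b' * u' ≤ a * V + b * u + b * (û - k)
      + c * (a' * β ^ 2 + (b - b')) * (y ^ 2 + y' ^ 2) := by
  have hb0 : 0 ≤ b := by rw [hb]; positivity
  have h1 : a' * V' ≤ a' * (1 - 2 * ψ * β) * V + b * φ + a' * β ^ 2 * L ^ 2 * y ^ 2 := by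
    rw [hb]
    calc a' * V' ≤ a' * ((1 - 2 * ψ * β) * V + 2 * β * φ + β ^ 2 * L ^ 2 * y ^ 2) := by gcongr
      _ = _ := by ring
  have h2 : a' * (1 - 2 * ψ * β) * V ≤ a * V := by gcongr
  have h3 : -(b - b') * u' ≤ (b - b') * (cu * D * (y ^ 2 + y' ^ 2)) := by
    have : -u' ≤ cu * D * (y ^ 2 + y' ^ 2) := by
      refine (neg_le_abs u').trans (hu'.trans ?_)
      gcongr
      nlinarith [sq_nonneg y]
    nlinarith [mul_le_mul_of_nonneg_left this (sub_nonneg.2 hbb)]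
  have h4 : b * (u' - û) ≤ a' * β ^ 2 * (cu * L * (y ^ 2 + y' ^ 2)) := by
    calc b * (u' - û) ≤ b * (cu * (β * L * y) * y') := by
          gcongr
          exact (le_abs_self _).trans hû
      _ = a' * β ^ 2 * (cu * L * (2 * (y * y'))) := by rw [hb]; ring
      _ ≤ _ := by
          gcongr
          nlinarith [sq_nonneg (y - y')]
  have h5 : a' * β ^ 2 * L ^ 2 * y ^ 2 ≤ a' * β ^ 2 * (L ^ 2 * (y ^ 2 + y' ^ 2)) := by
    rw [mul_assoc (a' * β ^ 2)]
    gcongr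
    nlinarith [sq_nonneg y']
  have h6 : (b - b') * (cu * D * (y ^ 2 + y' ^ 2)) ≤ (b - b') * (c * (y ^ 2 + y' ^ 2)) := by
    have : 0 ≤ b - b' := sub_nonneg.2 hbb
    gcongr
    nlinarith [mul_nonneg hcu hL, sq_nonneg L]
  have h7 : a' * β ^ 2 * ((cu * L + L ^ 2) * (y ^ 2 + y' ^ 2))
      ≤ a' * β ^ 2 * (c * (y ^ 2 + y' ^ 2)) := by
    gcongr
    nlinarith [mul_nonneg hcu hD]
  subst hφ
  linarith

/-- The Poisson correction is absorbed by half of the Lyapunov term. -/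
lemma half_weighted_le {V β a a' b u cu y c : ℝ}
    (hV : 0 ≤ V) (ha : 0 ≤ a) (ha' : 0 ≤ a') (hb : b = 2 * a' * β)
    (haa : a' ≤ 2 * a) (hu : u ^ 2 ≤ cu ^ 2 * V * y ^ 2) (hc : 4 * cu ^ 2 ≤ c) :
    1 / 2 * a * V ≤ a * V + b * u + c * (a' * β ^ 2) * y ^ 2 := by
  have hsq : (b * u) ^ 2 ≤ (1 / 2 * a * V + 4 * cu ^ 2 * (a' * β ^ 2) * y ^ 2) ^ 2 := by
    calc (b * u) ^ 2 = (4 * a' * β ^ 2) * a' * u ^ 2 := by rw [hb]; ring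
      _ ≤ (4 * a' * β ^ 2) * (2 * a) * (cu ^ 2 * V * y ^ 2) := by gcongr
      _ ≤ _ := by nlinarith [sq_nonneg (1 / 2 * a * V - 4 * cu ^ 2 * (a' * β ^ 2) * y ^ 2)]
  have h := (abs_le.1 (abs_le_of_sq_le_sq hsq (by positivity))).1
  have h2 : 4 * cu ^ 2 * (a' * β ^ 2) * y ^ 2 ≤ c * (a' * β ^ 2) * y ^ 2 := by gcongr
  linarith

end Weights

section Projection

variable {E : Type*} [NormedAddCommGroup E] [InnerProductSpace ℝ E] {B : ℝ}

lemma projB_of_norm_le {x : E} (hx : ‖x‖ ≤ B) : projB B x = x := if_pos hx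

lemma norm_projB_le (hB : 0 ≤ B) (x : E) : ‖projB B x‖ ≤ B := by
  unfold projB
  split_ifs with h
  · exact h
  · have hx : 0 < ‖x‖ := hB.trans_lt (not_le.1 h)
    rw [norm_smul, Real.norm_of_nonneg (by positivity), div_mul_cancel₀ _ hx.ne']

lemma norm_projB_sub_le (hB : 0 ≤ B) (x : E) {y : E} (hy : ‖y‖ ≤ B) :
    ‖projB B x - y‖ ≤ ‖x - y‖ := by
  unfold projB
  split_ifs with h
  · exact le_rfl
  · have hxB : B < ‖x‖ := not_le.1 h
    have hx : 0 < ‖x‖ := hB.trans_lt hxB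
    set r := B / ‖x‖ with hr
    have hr0 : 0 ≤ r := by positivity
    have hr1 : r ≤ 1 := (div_le_one hx).2 hxB.le
    have hrx : r * ‖x‖ = B := div_mul_cancel₀ _ hx.ne'
    refine le_of_sq_le_sq ?_ (norm_nonneg _)
    rw [norm_sub_sq_real, norm_sub_sq_real, inner_smul_left, norm_smul, Real.norm_of_nonneg hr0,
      hrx]
    have hin : inner ℝ x y ≤ ‖x‖ * B :=
      (real_inner_le_norm x y).trans (mul_le_mul_of_nonneg_left hy hx.le)
    simp only [conj_trivial]
    nlinarith [mul_nonneg (sub_nonneg.2 hr1) (sub_nonneg.2 hin)]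

lemma measurable_projB [MeasurableSpace E] [BorelSpace E] [SecondCountableTopology E] :
    Measurable (projB B : E → E) :=
  Measurable.ite (measurableSet_le measurable_norm measurable_const) measurable_id
    ((measurable_const.div measurable_norm).smul measurable_id)

end Projection

section Drift

variable {dW dL dX : ℕ} {ν : Measure (Wsp dW)}
  {G : Wsp dW → EuclideanSpace ℝ (Fin dL) → EuclideanSpace ℝ (Fin dX) → EuclideanSpace ℝ (Fin dL)}
  {H : Wsp dW → EuclideanSpace ℝ (Fin dX) → EuclideanSpace ℝ (Fin dX)}
  {lamStar : EuclideanSpace ℝ (Fin dL)} {xiStar : EuclideanSpace ℝ (Fin dX)} {B L ζ ψ : ℝ}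

lemma Assumption2.norm_xiStar_lt (hA2 : Assumption2 ν G H lamStar xiStar B L ζ ψ) :
    ‖xiStar‖ < B :=
  (le_max_right _ _).trans_lt hA2.hB

lemma Assumption2.B_pos (hA2 : Assumption2 ν G H lamStar xiStar B L ζ ψ) : 0 < B :=
  (norm_nonneg _).trans_lt hA2.norm_xiStar_lt

/-- The Lyapunov recursion for one projected step of the slow iterate. -/
lemma Assumption2.norm_sq_step_le (hA2 : Assumption2 ν G H lamStar xiStar B L ζ ψ) {β : ℝ}
    (hβ : 0 ≤ β) (y : Wsp dW) {x : EuclideanSpace ℝ (Fin dX)} (hx : ‖x‖ ≤ B) :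
    ‖projB B (x + β • H y x) - xiStar‖ ^ 2 ≤ (1 - 2 * ψ * β) * ‖x - xiStar‖ ^ 2
      + 2 * β * ⟪x - xiStar, H y x - ∫ z, H z x ∂ν⟫ + β ^ 2 * L ^ 2 * (1 + ‖y‖) ^ 2 := by
  have h1 : ‖projB B (x + β • H y x) - xiStar‖ ^ 2 ≤ ‖(x - xiStar) + β • H y x‖ ^ 2 := by
    have := norm_projB_sub_le hA2.B_pos.le (x + β • H y x) hA2.norm_xiStar_lt.le
    rw [add_sub_right_comm] at this
    gcongr
  have h2 := hA2.hHmono x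
  rw [hA2.hHstar, sub_zero] at h2
  have h3 : ‖β • H y x‖ ^ 2 ≤ β ^ 2 * L ^ 2 * (1 + ‖y‖) ^ 2 := by
    rw [norm_smul, Real.norm_of_nonneg hβ, mul_pow, mul_assoc, ← mul_pow L]
    gcongr
    exact hA2.hHgrow y x hx
  rw [norm_add_sq_real, inner_smul_right] at h1
  rw [inner_sub_right]
  nlinarith [mul_le_mul_of_nonneg_left h2 hβ]

lemma Assumption2.norm_step_sub_le (hA2 : Assumption2 ν G H lamStar xiStar B L ζ ψ) {β : ℝ}
    (hβ : 0 ≤ β) (y : Wsp dW) {x : EuclideanSpace ℝ (Fin dX)} (hx : ‖x‖ ≤ B) :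
    ‖projB B (x + β • H y x) - x‖ ≤ β * L * (1 + ‖y‖) := by
  refine (norm_projB_sub_le hA2.B_pos.le _ hx).trans ?_
  rw [add_sub_cancel_left, norm_smul, Real.norm_of_nonneg hβ, mul_assoc]
  gcongr
  exact hA2.hHgrow y x hx

/-- Poisson solution for the drift noise of the slow iterate. -/
lemma Assumption2.exists_poisson [IsProbabilityMeasure ν]
    (hA2 : Assumption2 ν G H lamStar xiStar B L ζ ψ)
    {K : Kernel (Wsp dW) (Wsp dW)} [IsMarkovKernel K] {c₁ ρ : ℝ} (hc₁ : 0 < c₁) (hρ₀ : 0 ≤ ρ)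
    (hρ₁ : ρ < 1) (hU : UdBound K ν c₁ ρ 1) :
    ∃ (u : Wsp dW → EuclideanSpace ℝ (Fin dX) → ℝ) (c : ℝ), 0 ≤ c ∧
      Measurable (Function.uncurry u) ∧
      (∀ w x, ‖x‖ ≤ B →
        ⟪x - xiStar, H w x - ∫ z, H z x ∂ν⟫ = u w x - ∫ y, u y x ∂(K w)) ∧
      (∀ w x, ‖x‖ ≤ B → |u w x| ≤ c * ‖x - xiStar‖ * (1 + ‖w‖)) ∧
      (∀ w x y, ‖x‖ ≤ B → ‖y‖ ≤ B → |u w x - u w y| ≤ c * ‖x - y‖ * (1 + ‖w‖)) := by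
  have hB := hA2.B_pos
  have hL := hA2.hL
  let h : Wsp dW → EuclideanSpace ℝ (Fin dX) → EuclideanSpace ℝ (Fin dX) :=
    fun w x => H w x - ∫ z, H z x ∂ν
  let φ : Wsp dW → EuclideanSpace ℝ (Fin dX) → ℝ :=
    fun w x => ⟪projB B x - xiStar, h w (projB B x)⟫
  have hg : Integrable (fun w : Wsp dW => 1 + ‖w‖) ν := by simpa only [Real.rpow_one] using hU.1
  set k := ∫ w, (1 + ‖w‖) ∂ν with hk
  have hk0 : 0 ≤ k := integral_nonneg fun w => by positivity
  have hHx : ∀ x, Measurable fun w => H w x := fun x => hA2.hHmeas.comp measurable_prodMk_right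
  have hHi : ∀ x, ‖x‖ ≤ B → Integrable (fun w => H w x) ν := fun x hx =>
    (hg.const_mul L).mono' (hHx x).aestronglyMeasurable (ae_of_all _ fun w => hA2.hHgrow w x hx)
  have hone : ∀ w : Wsp dW, 1 ≤ 1 + ‖w‖ := fun w => by linarith [norm_nonneg w]
  have hhb : ∀ w x, ‖x‖ ≤ B → ‖h w x‖ ≤ L * (1 + k) * (1 + ‖w‖) := fun w x hx => by
    have h1 : ‖∫ z, H z x ∂ν‖ ≤ L * k := by
      rw [hk, ← integral_const_mul]
      exact norm_integral_le_of_norm_le (hg.const_mul L)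
        (ae_of_all _ fun w => hA2.hHgrow w x hx)
    have h2 : L * k ≤ L * k * (1 + ‖w‖) := le_mul_of_one_le_right (by positivity) (hone w)
    linarith [norm_sub_le (H w x) (∫ z, H z x ∂ν), hA2.hHgrow w x hx]
  have hhl : ∀ w x y, ‖x‖ ≤ B → ‖y‖ ≤ B →
      ‖h w x - h w y‖ ≤ L * (1 + k) * (1 + ‖w‖) * ‖x - y‖ := fun w x y hx hy => by
    have h1 : ‖∫ z, H z x ∂ν - ∫ z, H z y ∂ν‖ ≤ L * k * ‖x - y‖ := by
      rw [← integral_sub (hHi x hx) (hHi y hy), hk, ← integral_const_mul, ← integral_mul_const]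
      exact norm_integral_le_of_norm_le ((hg.const_mul L).mul_const _)
        (ae_of_all _ fun w => hA2.hHLip w x y hx hy)
    have h2 : L * k * ‖x - y‖ ≤ L * k * ‖x - y‖ * (1 + ‖w‖) :=
      le_mul_of_one_le_right (by positivity) (hone w)
    have h3 : h w x - h w y = (H w x - H w y) - (∫ z, H z x ∂ν - ∫ z, H z y ∂ν) :=
      sub_sub_sub_comm _ _ _ _
    rw [h3]
    linarith [norm_sub_le (H w x - H w y) (∫ z, H z x ∂ν - ∫ z, H z y ∂ν),
      hA2.hHLip w x y hx hy]
  have hφb : ∀ x w, |φ w x| ≤ L * (1 + k) * ‖projB B x - xiStar‖ * (1 + ‖w‖) := fun x w => by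
    refine (abs_real_inner_le_norm _ _).trans ?_
    have := mul_le_mul_of_nonneg_left (hhb w _ (norm_projB_le hB.le x))
      (norm_nonneg (projB B x - xiStar))
    linarith
  have hφl : ∀ x y, ‖x‖ ≤ B → ‖y‖ ≤ B → ∀ w,
      |φ w x - φ w y| ≤ L * (1 + k) * (1 + 2 * B) * ‖x - y‖ * (1 + ‖w‖) := fun x y hx hy w => by
    simp only [φ, projB_of_norm_le hx, projB_of_norm_le hy]
    have hsplit : ⟪x - xiStar, h w x⟫ - ⟪y - xiStar, h w y⟫
        = ⟪x - y, h w x⟫ + ⟪y - xiStar, h w x - h w y⟫ := by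
      simp only [inner_sub_left, inner_sub_right]
      ring
    have hyB : ‖y - xiStar‖ ≤ 2 * B := by
      linarith [norm_sub_le y xiStar, hA2.norm_xiStar_lt]
    rw [hsplit]
    calc |⟪x - y, h w x⟫ + ⟪y - xiStar, h w x - h w y⟫|
        ≤ |⟪x - y, h w x⟫| + |⟪y - xiStar, h w x - h w y⟫| := abs_add_le _ _
      _ ≤ ‖x - y‖ * ‖h w x‖ + ‖y - xiStar‖ * ‖h w x - h w y‖ :=
          add_le_add (abs_real_inner_le_norm _ _) (abs_real_inner_le_norm _ _)
      _ ≤ ‖x - y‖ * (L * (1 + k) * (1 + ‖w‖))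
          + 2 * B * (L * (1 + k) * (1 + ‖w‖) * ‖x - y‖) := by
          gcongr
          · exact hhb w x hx
          · exact hhl w x y hx hy
      _ = _ := by ring
  have hφm : Measurable (Function.uncurry φ) := by
    have hp : Measurable fun q : Wsp dW × EuclideanSpace ℝ (Fin dX) => projB B q.2 :=
      measurable_projB.comp measurable_snd
    have hHbar : Measurable fun x => ∫ z, H z x ∂ν :=
      (StronglyMeasurable.integral_prod_left
        (f := fun z x => H z x) hA2.hHmeas.stronglyMeasurable).measurable
    exact (hp.sub_const _).inner
      ((hA2.hHmeas.comp (measurable_fst.prodMk hp)).sub (hHbar.comp hp))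
  have hφ0 : ∀ x, ∫ w, φ w x ∂ν = 0 := fun x => by
    have hi := hHi _ (norm_projB_le hB.le x)
    refine (integral_inner (f := fun w => H w (projB B x) - ∫ z, H z (projB B x) ∂ν)
      (hi.sub (integrable_const _)) _).trans ?_
    rw [integral_sub hi (integrable_const _)]
    simp
  obtain ⟨u, hum, hpois, hub, hul⟩ := hU.exists_poisson hρ₀ hρ₁ hφm
    (fun x => ⟨L * (1 + k) * ‖projB B x - xiStar‖, by positivity, hφb x⟩) hφ0
  have hcρ : 0 ≤ c₁ / (1 - ρ) := div_nonneg hc₁.le (sub_nonneg.2 hρ₁.le)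
  refine ⟨u, c₁ / (1 - ρ) * (L * (1 + k) * (1 + 2 * B)), by positivity, hum, fun w x hx => ?_,
    fun w x hx => ?_, fun w x y hx hy => ?_⟩
  · rw [hpois]
    simp only [φ, h, projB_of_norm_le hx]
  · refine (hub x _ (by positivity) (hφb x) w).trans ?_
    have h1 : L * (1 + k) ≤ L * (1 + k) * (1 + 2 * B) :=
      le_mul_of_one_le_right (by positivity) (by linarith)
    rw [projB_of_norm_le hx, ← mul_assoc]
    exact mul_le_mul_of_nonneg_right (mul_le_mul_of_nonneg_right
      (mul_le_mul_of_nonneg_left h1 hcρ) (norm_nonneg _)) (by positivity)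
  · refine (hul x y _ (by positivity) (hφl x y hx hy) w).trans_eq ?_
    ring

end Drift

section Iterates

variable {dW dX : ℕ} {Ω : Type*} {Wp : ℕ → Ω → Wsp dW}
  {H : Wsp dW → EuclideanSpace ℝ (Fin dX) → EuclideanSpace ℝ (Fin dX)}
  {β : ℕ → ℝ} {B : ℝ} {xi0 : EuclideanSpace ℝ (Fin dX)}

lemma norm_xiSeq_le (hB : 0 ≤ B) (hxi0 : ‖xi0‖ ≤ B) (t : ℕ) (ω : Ω) :
    ‖xiSeq H β B Wp xi0 t ω‖ ≤ B := by
  cases t with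
  | zero => exact hxi0
  | succ t => exact norm_projB_le hB _

variable [mΩ : MeasurableSpace Ω] {K : Kernel (Wsp dW) (Wsp dW)} {P : Measure Ω} {w : Wsp dW}

lemma IsMarkovProc.measurable_xiSeq (hMP : IsMarkovProc K P Wp w)
    (hH : Measurable fun p : Wsp dW × EuclideanSpace ℝ (Fin dX) => H p.1 p.2) {s t : ℕ}
    (hts : t ≤ s + 1) : Measurable[hMP.filtration s] (xiSeq H β B Wp xi0 t) := by
  induction t with
  | zero => exact measurable_const
  | succ t ih =>
    have hx := ih (by omega)
    have hW := hMP.measurable_filtration (show t ≤ s by omega)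
    exact measurable_projB.comp (hx.add ((hH.comp (hW.prodMk hx)).const_smul (β t)))

/-- A time-shifted filtration. -/
def MeasureTheory.Filtration.shift (ℱ : Filtration ℕ mΩ) (T : ℕ) : Filtration ℕ mΩ where
  seq k := ℱ (T + k)
  mono' _ _ hij := ℱ.mono (Nat.add_le_add_left hij T)
  le' k := ℱ.le (T + k)

end Iterates

section Weighted

variable {dW dL dX : ℕ} {Ω : Type*} {K : Kernel (Wsp dW) (Wsp dW)} {Wp : ℕ → Ω → Wsp dW}
  {ν : Measure (Wsp dW)}
  {G : Wsp dW → EuclideanSpace ℝ (Fin dL) → EuclideanSpace ℝ (Fin dX) → EuclideanSpace ℝ (Fin dL)}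
  {H : Wsp dW → EuclideanSpace ℝ (Fin dX) → EuclideanSpace ℝ (Fin dX)}
  {lamStar : EuclideanSpace ℝ (Fin dL)} {xiStar : EuclideanSpace ℝ (Fin dX)} {B L ζ ψ : ℝ}
  {xi0 : EuclideanSpace ℝ (Fin dX)}

/-- Admissible weights from time `T` on: they grow slower than the contraction of the iterate, and
`a (t + 1) * β t` is nonincreasing. -/
structure AdmissibleWeights (ψ : ℝ) (a β : ℕ → ℝ) (T : ℕ) : Prop where
  nonneg : ∀ t, T ≤ t → 0 ≤ a t
  step_nonneg : ∀ t, T ≤ t → 0 ≤ β t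
  contract : ∀ t, T ≤ t → a (t + 1) * (1 - 2 * ψ * β t) ≤ a t
  double : ∀ t, T ≤ t → a (t + 1) ≤ 2 * a t
  anti : ∀ t, T ≤ t → a (t + 2) * β (t + 1) ≤ a (t + 1) * β t

/-- Pathwise domination of the weighted squared error by martingale increments and remainders. -/
lemma Assumption2.weighted_path_le (hA2 : Assumption2 ν G H lamStar xiStar B L ζ ψ)
    {u : Wsp dW → EuclideanSpace ℝ (Fin dX) → ℝ} {cu c : ℝ} (hcu : 0 ≤ cu)
    (hpois : ∀ w x, ‖x‖ ≤ B →
      ⟪x - xiStar, H w x - ∫ z, H z x ∂ν⟫ = u w x - ∫ y, u y x ∂(K w))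
    (hub : ∀ w x, ‖x‖ ≤ B → |u w x| ≤ cu * ‖x - xiStar‖ * (1 + ‖w‖))
    (hul : ∀ w x y, ‖x‖ ≤ B → ‖y‖ ≤ B → |u w x - u w y| ≤ cu * ‖x - y‖ * (1 + ‖w‖))
    (hc : cu * (2 * B) + cu * L + L ^ 2 ≤ c) (hc4 : 4 * cu ^ 2 ≤ c) (hxi0 : ‖xi0‖ ≤ B)
    {a β : ℕ → ℝ} {T : ℕ} (hw : AdmissibleWeights ψ a β T) {b e : ℕ → ℝ}
    (hb : ∀ t, b t = 2 * a (t + 1) * β t)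
    (he : ∀ t, e t = a (t + 1) * β t ^ 2 + (b t - b (t + 1))) (n : ℕ) (ω : Ω) :
    1 / 2 * a (T + n) * ‖xiSeq H β B Wp xi0 (T + n) ω - xiStar‖ ^ 2
      ≤ (a T * ‖xiSeq H β B Wp xi0 T ω - xiStar‖ ^ 2
          + b T * u (Wp T ω) (xiSeq H β B Wp xi0 T ω) + c * e T * (1 + ‖Wp T ω‖) ^ 2)
        + ∑ j ∈ Finset.range n,
          (b (T + j) * (u (Wp (T + j + 1) ω) (xiSeq H β B Wp xi0 (T + j) ω)
              - ∫ y, u y (xiSeq H β B Wp xi0 (T + j) ω) ∂(K (Wp (T + j) ω)))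
            + (c * e (T + j) * ((1 + ‖Wp (T + j) ω‖) ^ 2 + (1 + ‖Wp (T + j + 1) ω‖) ^ 2)
              + c * e (T + j + 1) * (1 + ‖Wp (T + j + 1) ω‖) ^ 2)) := by
  have hB := hA2.B_pos
  have hL := hA2.hL
  have hc0 : 0 ≤ c := by nlinarith [sq_nonneg cu]
  have hone : ∀ t, 1 ≤ 1 + ‖Wp t ω‖ := fun t => by linarith [norm_nonneg (Wp t ω)]
  set X : ℕ → EuclideanSpace ℝ (Fin dX) := fun t => xiSeq H β B Wp xi0 t ω
  have hXB : ∀ t, ‖X t‖ ≤ B := fun t => norm_xiSeq_le hB.le hxi0 t ω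
  have hXsucc : ∀ t, X (t + 1) = projB B (X t + β t • H (Wp t ω) (X t)) := fun t => rfl
  have hbb : ∀ t, T ≤ t → b (t + 1) ≤ b t := fun t ht => by
    rw [hb, hb]; linarith [hw.anti t ht]
  have hele : ∀ t, T ≤ t → a (t + 1) * β t ^ 2 ≤ e t := fun t ht => by
    rw [he]; linarith [hbb t ht]
  have he0 : ∀ t, T ≤ t → 0 ≤ e t := fun t ht =>
    (mul_nonneg (hw.nonneg _ (by omega)) (sq_nonneg _)).trans (hele t ht)
  have hstep : ∀ t, T ≤ t → a (t + 1) * ‖X (t + 1) - xiStar‖ ^ 2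
      + b (t + 1) * u (Wp (t + 1) ω) (X (t + 1)) ≤ a t * ‖X t - xiStar‖ ^ 2
      + b t * u (Wp t ω) (X t)
      + b t * (u (Wp (t + 1) ω) (X t) - ∫ y, u y (X t) ∂(K (Wp t ω)))
      + c * e t * ((1 + ‖Wp t ω‖) ^ 2 + (1 + ‖Wp (t + 1) ω‖) ^ 2) := fun t ht => by
    have hβ := hw.step_nonneg t ht
    rw [he]
    refine weighted_step (D := 2 * B) (sq_nonneg _) hβ (hw.nonneg _ (by omega)) (hb t)
      (hbb t ht) (hw.contract t ht) hL.le hcu (by positivity) (hone _)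
      (hA2.norm_sq_step_le hβ (Wp t ω) (hXB t)) (hpois _ _ (hXB t)) ?_ ?_ hc
    · refine (hub _ _ (hXB _)).trans ?_
      gcongr
      linarith [norm_sub_le (X (t + 1)) xiStar, hXB (t + 1), hA2.norm_xiStar_lt]
    · refine (hul _ _ _ (hXB _) (hXB _)).trans ?_
      gcongr
      exact hA2.norm_step_sub_le hβ (Wp t ω) (hXB t)
  have hhalf : ∀ t, T ≤ t → 1 / 2 * a t * ‖X t - xiStar‖ ^ 2 ≤ a t * ‖X t - xiStar‖ ^ 2
      + b t * u (Wp t ω) (X t) + c * e t * (1 + ‖Wp t ω‖) ^ 2 := fun t ht => by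
    have hsq : u (Wp t ω) (X t) ^ 2 ≤ cu ^ 2 * ‖X t - xiStar‖ ^ 2 * (1 + ‖Wp t ω‖) ^ 2 := by
      rw [← mul_pow, ← mul_pow, ← sq_abs]
      gcongr
      exact hub _ _ (hXB t)
    refine (half_weighted_le (sq_nonneg _) (hw.nonneg t ht) (hw.nonneg _ (by omega)) (hb t)
      (hw.double t ht) hsq hc4).trans ?_
    gcongr
    exact hele t ht
  suffices hsum : a (T + n) * ‖X (T + n) - xiStar‖ ^ 2 + b (T + n) * u (Wp (T + n) ω) (X (T + n))
      + c * e (T + n) * (1 + ‖Wp (T + n) ω‖) ^ 2 ≤ _ from (hhalf _ (by omega)).trans hsum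
  induction n with
  | zero => simp [X]
  | succ n ih =>
    rw [Finset.sum_range_succ, ← add_assoc]
    have h1 := hstep (T + n) (by omega)
    have h2 : 0 ≤ c * e (T + n) * (1 + ‖Wp (T + n) ω‖) ^ 2 :=
      mul_nonneg (mul_nonneg hc0 (he0 _ (by omega))) (sq_nonneg _)
    linarith

variable [mΩ : MeasurableSpace Ω] {P : Measure Ω} {w : Wsp dW}
  [IsMarkovKernel K] [IsProbabilityMeasure P] [IsProbabilityMeasure ν]

/-- Mean and maximal bounds for the weighted squared error of the slow iterate, with a constant
that does not depend on the weights, the step sizes or the starting time. -/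
lemma Assumption2.exists_weighted_bound (hA2 : Assumption2 ν G H lamStar xiStar B L ζ ψ)
    {c₁ ρ : ℝ} (hc₁ : 0 < c₁) (hρ₀ : 0 ≤ ρ) (hρ₁ : ρ < 1)
    (hU1 : UdBound K ν c₁ ρ 1) (hU2 : UdBound K ν c₁ ρ 2) (hMP : IsMarkovProc K P Wp w)
    (hxi0 : ‖xi0‖ ≤ B) :
    ∃ C : ℝ, 0 ≤ C ∧ ∀ (a β : ℕ → ℝ) (T : ℕ), AdmissibleWeights ψ a β T → ∀ n : ℕ, ∀ R : ℝ,
      a T * ∫ ω, ‖xiSeq H β B Wp xi0 T ω - xiStar‖ ^ 2 ∂P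
        + C * (a (T + 1) * β T
          + ∑ j ∈ Finset.range (n + 1), a (T + j + 1) * β (T + j) ^ 2) ≤ R →
      1 / 2 * a (T + n) * ∫ ω, ‖xiSeq H β B Wp xi0 (T + n) ω - xiStar‖ ^ 2 ∂P ≤ R ∧
      ∀ ε : ℝ, 0 < ε → P {ω | ∃ k ≤ n,
        ε ≤ 1 / 2 * a (T + k) * ‖xiSeq H β B Wp xi0 (T + k) ω - xiStar‖ ^ 2}
          ≤ ENNReal.ofReal (R / ε) := by
  obtain ⟨u, cu, hcu, hum, hpois, hub, hul⟩ := hA2.exists_poisson hc₁ hρ₀ hρ₁ hU1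
  obtain ⟨M, hM⟩ := hMP.exists_moment_bound hc₁ hρ₀ hρ₁ hU2
  have hB := hA2.B_pos
  have hL := hA2.hL
  have hM0 : 0 ≤ M := (integral_nonneg fun ω => sq_nonneg _).trans (hM 0).2
  set c : ℝ := cu * (2 * B) + cu * L + L ^ 2 + 4 * cu ^ 2 with hc
  have hc0 : 0 ≤ c := by positivity
  have hyi : ∀ t, Integrable (fun ω => (1 + ‖Wp t ω‖) ^ 2) P := fun t => (hM t).1
  have hy1 : ∀ t ω, 1 + ‖Wp t ω‖ ≤ (1 + ‖Wp t ω‖) ^ 2 := fun t ω => by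
    nlinarith [norm_nonneg (Wp t ω)]
  refine ⟨2 * (cu * (2 * B) * M + 3 * (c * M)) + 3 * (c * M), by positivity,
    fun a β T hw n R hR => ?_⟩
  let X : ℕ → Ω → EuclideanSpace ℝ (Fin dX) := xiSeq H β B Wp xi0
  have hXB : ∀ t ω, ‖X t ω‖ ≤ B := fun t ω => norm_xiSeq_le hB.le hxi0 t ω
  have hXD : ∀ t ω, ‖X t ω - xiStar‖ ≤ 2 * B := fun t ω => by
    linarith [norm_sub_le (X t ω) xiStar, hXB t ω, hA2.norm_xiStar_lt]
  have hXm : ∀ {s t : ℕ}, t ≤ s + 1 → Measurable[hMP.filtration s] (X t) := fun h =>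
    hMP.measurable_xiSeq hA2.hHmeas h
  have hWm : ∀ {s t : ℕ}, t ≤ s → Measurable[hMP.filtration s] (Wp t) := fun h =>
    hMP.measurable_filtration h
  have hle : ∀ t, hMP.filtration t ≤ mΩ := hMP.filtration.le
  have hubX : ∀ s t ω, |u (Wp s ω) (X t ω)| ≤ cu * (2 * B) * (1 + ‖Wp s ω‖) ^ 2 := fun s t ω => by
    refine (hub _ _ (hXB t ω)).trans ?_
    gcongr
    · exact hXD t ω
    · exact hy1 s ω
  have huXm : ∀ {r s t : ℕ}, s ≤ r → t ≤ r + 1 →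
      Measurable[hMP.filtration r] fun ω => u (Wp s ω) (X t ω) := fun hs ht =>
    hum.comp ((hWm hs).prodMk (hXm ht))
  have huXi : ∀ s t, t ≤ s + 1 → Integrable (fun ω => u (Wp s ω) (X t ω)) P := fun s t hst =>
    ((hyi s).const_mul (cu * (2 * B))).mono'
      ((huXm le_rfl hst).mono (hle s) le_rfl).aestronglyMeasurable (ae_of_all _ (hubX s t))
  have hK : ∀ t, (fun ω => ∫ y, u y (X t ω) ∂(K (Wp t ω))) = fun ω => u (Wp t ω) (X t ω)
      - ⟪X t ω - xiStar, H (Wp t ω) (X t ω) - ∫ z, H z (X t ω) ∂ν⟫ := fun t => by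
    ext ω
    rw [hpois _ _ (hXB t ω)]
    ring
  have hKm : ∀ t, Measurable[hMP.filtration t]
      fun ω => ∫ y, u y (X t ω) ∂(K (Wp t ω)) := fun t => by
    have hHbar : Measurable fun x => ∫ z, H z x ∂ν :=
      (StronglyMeasurable.integral_prod_left
        (f := fun z x => H z x) hA2.hHmeas.stronglyMeasurable).measurable
    have hXt : Measurable[hMP.filtration t] (X t) := hXm (Nat.le_succ t)
    rw [hK]
    exact (huXm le_rfl (Nat.le_succ t)).sub ((hXt.sub_const _).inner
      ((hA2.hHmeas.comp ((hWm le_rfl).prodMk hXt)).sub (hHbar.comp hXt)))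
  let b : ℕ → ℝ := fun t => 2 * a (t + 1) * β t
  let e : ℕ → ℝ := fun t => a (t + 1) * β t ^ 2 + (b t - b (t + 1))
  have hbb : ∀ t, T ≤ t → b (t + 1) ≤ b t := fun t ht => by
    simp only [b]; linarith [hw.anti t ht]
  have hb0 : ∀ t, T ≤ t → 0 ≤ b t := fun t ht =>
    mul_nonneg (mul_nonneg zero_le_two (hw.nonneg _ (by omega))) (hw.step_nonneg t ht)
  have he0 : ∀ t, T ≤ t → 0 ≤ e t := fun t ht =>
    add_nonneg (mul_nonneg (hw.nonneg _ (by omega)) (sq_nonneg _)) (sub_nonneg.2 (hbb t ht))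
  let V : ℕ → Ω → ℝ := fun t ω => ‖X t ω - xiStar‖ ^ 2
  let y : ℕ → Ω → ℝ := fun t ω => (1 + ‖Wp t ω‖) ^ 2
  have hym : ∀ {r s : ℕ}, s ≤ r → Measurable[hMP.filtration r] (y s) := fun hs =>
    ((measurable_const.add measurable_norm).pow_const 2).comp (hWm hs)
  let q : Ω → ℝ := fun ω => a T * V T ω + b T * u (Wp T ω) (X T ω) + c * e T * y T ω
  let N : ℕ → Ω → ℝ := fun j ω => b (T + j) * (u (Wp (T + j + 1) ω) (X (T + j) ω)
    - ∫ z, u z (X (T + j) ω) ∂(K (Wp (T + j) ω)))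
  let D : ℕ → Ω → ℝ := fun j ω => c * e (T + j) * (y (T + j) ω + y (T + j + 1) ω)
    + c * e (T + j + 1) * y (T + j + 1) ω
  have hVm : ∀ t, Measurable[hMP.filtration t] (V t) := fun t =>
    ((measurable_id.sub_const xiStar).norm.pow_const 2).comp (hXm (Nat.le_succ t))
  have hVi : ∀ t, Integrable (V t) P := fun t =>
    (integrable_const ((2 * B) ^ 2)).mono' ((hVm t).mono (hle t) le_rfl).aestronglyMeasurable
      (ae_of_all _ fun ω => by
        rw [Real.norm_of_nonneg (sq_nonneg _)]
        exact pow_le_pow_left₀ (norm_nonneg _) (hXD t ω) 2)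
  have hKi : ∀ t, Integrable (fun ω => ∫ z, u z (X t ω) ∂(K (Wp t ω))) P := fun t => by
    have h := (hMP.integrableOn_and_setIntegral_succ t MeasurableSet.univ (hXm (Nat.le_succ t)) hum
      (huXi _ _ (by omega))).1
    rwa [integrableOn_univ] at h
  have hqi : Integrable q P := (((hVi T).const_mul _).add
    ((huXi T T (Nat.le_succ T)).const_mul _)).add ((hyi T).const_mul _)
  have hDi : ∀ j, Integrable (D j) P := fun j =>
    (((hyi (T + j)).add (hyi (T + j + 1))).const_mul _).add ((hyi (T + j + 1)).const_mul _)
  have hmain := integral_le_and_maximal_le (ℱ := hMP.filtration.shift T) (q := q) (N := N) (D := D)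
    (v := fun k ω => 1 / 2 * a (T + k) * V (T + k) ω)
    ((((hVm T).const_mul _).add ((huXm le_rfl (Nat.le_succ T)).const_mul _)).add
      ((hym le_rfl).const_mul _)) hqi
    (fun k => ((huXm le_rfl (by omega)).sub
      ((hKm (T + k)).mono (hMP.filtration.mono (Nat.le_succ _)) le_rfl)).const_mul _)
    (fun k => ((huXi _ _ (by omega)).sub (hKi _)).const_mul _)
    (fun k A hA => by
      have hA' : MeasurableSet[hMP.filtration (T + k)] A := hA
      have h := (hMP.integrableOn_and_setIntegral_succ (T + k) hA' (hXm (Nat.le_succ (T + k))) hum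
        (huXi _ _ (by omega))).2
      simp only [N]
      rw [integral_const_mul, integral_sub (huXi _ _ (by omega)).integrableOn (hKi _).integrableOn,
        h, sub_self, mul_zero])
    (fun k => ((((hym (Nat.le_succ _)).add (hym le_rfl)).const_mul _).add
      ((hym le_rfl).const_mul _)))
    hDi
    (fun k ω => add_nonneg
      (mul_nonneg (mul_nonneg hc0 (he0 _ (by omega))) (add_nonneg (sq_nonneg _) (sq_nonneg _)))
      (mul_nonneg (mul_nonneg hc0 (he0 _ (by omega))) (sq_nonneg _)))
    (fun k ω => mul_nonneg (mul_nonneg (by norm_num) (hw.nonneg _ (by omega))) (sq_nonneg _))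
    (hA2.weighted_path_le hcu hpois hub hul (by nlinarith [sq_nonneg cu])
      (by nlinarith [mul_nonneg hcu hL.le, mul_nonneg hcu hB.le, sq_nonneg L]) hxi0 hw
      (fun _ => rfl) (fun _ => rfl)) n
  have hq : ∫ ω, q ω ∂P ≤ a T * ∫ ω, V T ω ∂P + b T * (cu * (2 * B) * M) + c * e T * M := by
    have h0 : ∫ ω, q ω ∂P = a T * ∫ ω, V T ω ∂P + b T * ∫ ω, u (Wp T ω) (X T ω) ∂P
        + c * e T * ∫ ω, y T ω ∂P := by
      refine (integral_add (((hVi T).const_mul _).add ((huXi T T (Nat.le_succ T)).const_mul _))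
        ((hyi T).const_mul _)).trans (congrArg₂ _ ((integral_add ((hVi T).const_mul _)
        ((huXi T T (Nat.le_succ T)).const_mul _)).trans ?_) (integral_const_mul _ _))
      rw [integral_const_mul, integral_const_mul]
    have h1 : ∫ ω, u (Wp T ω) (X T ω) ∂P ≤ cu * (2 * B) * M := by
      calc ∫ ω, u (Wp T ω) (X T ω) ∂P ≤ ∫ ω, cu * (2 * B) * y T ω ∂P :=
            integral_mono (huXi T T (Nat.le_succ T)) ((hyi T).const_mul _)
              fun ω => (le_abs_self _).trans (hubX T T ω)
        _ ≤ _ := by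
            rw [integral_const_mul]
            exact mul_le_mul_of_nonneg_left (hM T).2 (by positivity)
    rw [h0]
    exact add_le_add (add_le_add le_rfl (mul_le_mul_of_nonneg_left h1 (hb0 T le_rfl)))
      (mul_le_mul_of_nonneg_left (hM T).2 (mul_nonneg hc0 (he0 T le_rfl)))
  have hDint : ∀ j, ∫ ω, D j ω ∂P ≤ c * M * (2 * e (T + j) + e (T + j + 1)) := fun j => by
    have h0 : ∫ ω, D j ω ∂P = c * e (T + j) * (∫ ω, y (T + j) ω ∂P + ∫ ω, y (T + j + 1) ω ∂P)
        + c * e (T + j + 1) * ∫ ω, y (T + j + 1) ω ∂P := by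
      refine (integral_add (((hyi (T + j)).add (hyi (T + j + 1))).const_mul _)
        ((hyi (T + j + 1)).const_mul _)).trans (congrArg₂ _ ?_ (integral_const_mul _ _))
      exact (integral_const_mul _ _).trans
        (congrArg _ (integral_add (hyi (T + j)) (hyi (T + j + 1))))
    rw [h0]
    have h1 := mul_le_mul_of_nonneg_left (add_le_add (hM (T + j)).2 (hM (T + j + 1)).2)
      (mul_nonneg hc0 (he0 (T + j) (by omega)))
    have h2 := mul_le_mul_of_nonneg_left (hM (T + j + 1)).2
      (mul_nonneg hc0 (he0 (T + j + 1) (by omega)))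
    linarith
  have hcM : 0 ≤ c * M := mul_nonneg hc0 hM0
  have htel : ∀ m, ∑ j ∈ Finset.range (m + 1), e (T + j)
      = ∑ j ∈ Finset.range (m + 1), a (T + j + 1) * β (T + j) ^ 2 + (b T - b (T + m + 1)) :=
    fun m => by
    simp only [e]
    rw [Finset.sum_add_distrib]
    exact congrArg _ (Finset.sum_range_sub' (fun j => b (T + j)) (m + 1))
  have hesum : c * e T * M + ∑ j ∈ Finset.range n, c * M * (2 * e (T + j) + e (T + j + 1))
      ≤ 3 * (c * M) * ∑ j ∈ Finset.range (n + 1), e (T + j) := by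
    have h1 := Finset.sum_range_succ (fun j => e (T + j)) n
    have h2 := Finset.sum_range_succ' (fun j => e (T + j)) n
    have h3 : ∑ j ∈ Finset.range n, c * M * (2 * e (T + j) + e (T + j + 1))
        = c * M * (2 * ∑ j ∈ Finset.range n, e (T + j)
          + ∑ j ∈ Finset.range n, e (T + (j + 1))) := by
      rw [← Finset.mul_sum, Finset.sum_add_distrib, ← Finset.mul_sum]
      rfl
    have h4 := mul_nonneg hcM (he0 (T + n) (by omega))
    rw [h3]
    simp only [add_zero] at h2
    have h5 : ∑ j ∈ Finset.range n, e (T + (j + 1))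
      = ∑ j ∈ Finset.range (n + 1), e (T + j) - e T := by linarith
    have h6 : ∑ j ∈ Finset.range n, e (T + j)
      = ∑ j ∈ Finset.range (n + 1), e (T + j) - e (T + n) := by linarith
    rw [h5, h6]
    linarith
  have htot : ∫ ω, q ω ∂P + ∑ j ∈ Finset.range n, ∫ ω, D j ω ∂P ≤ R := by
    refine le_trans ?_ hR
    have h1 := Finset.sum_le_sum fun j (_ : j ∈ Finset.range n) => hDint j
    have h2 := hesum
    rw [htel] at h2
    have h3 : 0 ≤ c * M * b (T + n + 1) := mul_nonneg hcM (hb0 _ (by omega))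
    have h4 : 0 ≤ ∑ j ∈ Finset.range (n + 1), a (T + j + 1) * β (T + j) ^ 2 :=
      Finset.sum_nonneg fun j _ => mul_nonneg (hw.nonneg _ (by omega)) (sq_nonneg _)
    have h5 : b T = 2 * (a (T + 1) * β T) := mul_assoc _ _ _
    have h6 := mul_nonneg (mul_nonneg (mul_nonneg hcu hB.le) hM0) h4
    have h7 := mul_nonneg hcM h4
    have h8 : 0 ≤ a (T + 1) * β T := mul_nonneg (hw.nonneg _ (by omega)) (hw.step_nonneg T le_rfl)
    have h9 := mul_nonneg hcM h8
    rw [h5] at hq h2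
    linarith
  refine ⟨?_, fun ε hε => (hmain.2 ε hε).trans (ENNReal.ofReal_le_ofReal (by gcongr))⟩
  rw [← integral_const_mul]
  exact hmain.1.trans htot

end Weighted

section Power

lemma add_one_rpow_le {x γ : ℝ} (hx : 0 < x) (hγ₁ : γ ≤ 1) :
    (x + 1) ^ γ ≤ x ^ γ * (1 + 1 / x) := by
  have h1 : x + 1 = x * (1 + 1 / x) := by field_simp
  have hpos : 0 < 1 / x := by positivity
  rw [h1, Real.mul_rpow hx.le (by positivity)]
  gcongr
  calc (1 + 1 / x) ^ γ ≤ (1 + 1 / x) ^ (1 : ℝ) :=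
        Real.rpow_le_rpow_of_exponent_le (by linarith) hγ₁
    _ = _ := Real.rpow_one _

lemma add_one_rpow_le_two_mul {x γ : ℝ} (hx : 1 ≤ x) (hγ₁ : γ ≤ 1) :
    (x + 1) ^ γ ≤ 2 * x ^ γ := by
  have hx0 : 0 < x := by linarith
  refine (add_one_rpow_le hx0 hγ₁).trans ?_
  rw [mul_comm]
  gcongr
  have : 1 / x ≤ 1 := (div_le_one hx0).2 hx
  linarith

lemma exists_admissibleWeights_rpow {ψ β₀ δ γ : ℝ} (hψ : 0 < ψ) (hβ₀ : 0 < β₀) (hδ : δ < 1)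
    (hγ₀ : 0 ≤ γ) (hγδ : γ ≤ δ) :
    ∃ T₀ : ℕ, ∀ T, T₀ ≤ T →
      AdmissibleWeights ψ (fun t => (t : ℝ) ^ γ) (fun t => β₀ * (t : ℝ) ^ (-δ)) T := by
  have hlim : Tendsto (fun t : ℕ => (t : ℝ) ^ (1 - δ)) atTop atTop :=
    (tendsto_rpow_atTop (sub_pos.2 hδ)).comp tendsto_natCast_atTop_atTop
  obtain ⟨T₁, hT₁⟩ := eventually_atTop.1 (hlim.eventually_ge_atTop (1 / (2 * ψ * β₀)))
  refine ⟨max T₁ 1, fun T hT => ?_⟩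
  have hpos : ∀ t, T ≤ t → (1 : ℝ) ≤ t := fun t ht => by
    exact_mod_cast ((le_max_right _ _).trans hT).trans ht
  refine ⟨fun t _ => by positivity, fun t _ => by positivity, fun t ht => ?_, fun t ht => ?_,
    fun t ht => ?_⟩
  · have hx := hpos t ht
    have hx0 : (0 : ℝ) < t := by linarith
    push_cast
    have h1 := add_one_rpow_le hx0 (hγδ.trans hδ.le)
    have h2 : (t : ℝ) ^ γ ≤ (t + 1) ^ γ := by gcongr; linarith
    have h3 : 1 / (t : ℝ) ≤ 2 * ψ * (β₀ * (t : ℝ) ^ (-δ)) := by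
      have h4 := hT₁ t (((le_max_left _ _).trans hT).trans ht)
      rw [div_le_iff₀ (by positivity)] at h4
      rw [div_le_iff₀ hx0]
      have h5 : (t : ℝ) ^ (1 - δ) = t ^ (-δ) * t := by
        rw [← Real.rpow_add_one hx0.ne']
        congr 1
        ring
      rw [h5] at h4
      linarith
    have h6 := mul_le_mul_of_nonneg_left h3 (show (0 : ℝ) ≤ (t : ℝ) ^ γ by positivity)
    have h7 := mul_le_mul_of_nonneg_right h2
      (show 0 ≤ 2 * ψ * (β₀ * (t : ℝ) ^ (-δ)) by positivity)
    linarith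
  · push_cast
    exact add_one_rpow_le_two_mul (hpos t ht) (hγδ.trans hδ.le)
  · have hx := hpos t ht
    have hx0 : (0 : ℝ) < t := by linarith
    push_cast
    have h1 : ((t : ℝ) + 2) ^ γ * t ^ δ ≤ (t + 1) ^ γ * (t + 1) ^ δ := by
      have h2 : (((t : ℝ) + 2) / (t + 1)) ^ γ ≤ ((t + 1) / t) ^ δ := by
        calc (((t : ℝ) + 2) / (t + 1)) ^ γ ≤ ((t + 1) / t) ^ γ := by
              refine Real.rpow_le_rpow (by positivity) ?_ hγ₀
              rw [div_le_div_iff₀ (by positivity) hx0]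
              nlinarith
          _ ≤ _ := Real.rpow_le_rpow_of_exponent_le ((one_le_div hx0).2 (by linarith)) hγδ
      rwa [Real.div_rpow (by positivity) (by positivity), Real.div_rpow (by positivity) hx0.le,
        div_le_div_iff₀ (by positivity) (by positivity), mul_comm ((_ + 1 : ℝ) ^ δ)] at h2
    rw [Real.rpow_neg hx0.le, Real.rpow_neg (by positivity)]
    have h3 : ((t : ℝ) + 2) ^ γ * (((t : ℝ) + 1) ^ δ)⁻¹ ≤ ((t : ℝ) + 1) ^ γ * ((t : ℝ) ^ δ)⁻¹ := by
      rwa [← div_eq_mul_inv, ← div_eq_mul_inv, div_le_div_iff₀ (by positivity) (by positivity)]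
    have h4 := mul_le_mul_of_nonneg_left h3 hβ₀.le
    linarith

lemma sub_one_rpow_le {x p : ℝ} (hx : 1 ≤ x) (hp₀ : 0 ≤ p) (hp₁ : p ≤ 1) :
    (x - 1) ^ p ≤ x ^ p - p * x ^ (p - 1) := by
  have hx0 : 0 < x := by linarith
  have hs : 1 / x ≤ 1 := (div_le_one hx0).2 hx
  have h1 : x - 1 = x * (1 + -(1 / x)) := by field_simp; ring
  have h2 := rpow_one_add_le_one_add_mul_self (s := -(1 / x)) (by linarith) hp₀ hp₁
  rw [h1, Real.mul_rpow hx0.le (by linarith), Real.rpow_sub_one hx0.ne']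
  calc x ^ p * (1 + -(1 / x)) ^ p ≤ x ^ p * (1 + p * -(1 / x)) := by gcongr
    _ = _ := by field_simp; ring

lemma sum_rpow_neg_le {T : ℕ} (hT : 1 ≤ T) {δ : ℝ} (hδ₀ : 0 ≤ δ) (hδ₁ : δ < 1) (n : ℕ) :
    ∑ j ∈ Finset.range (n + 1), ((T + j : ℕ) : ℝ) ^ (-δ)
      ≤ 1 / (1 - δ) * ((T + n : ℕ) : ℝ) ^ (1 - δ) := by
  have hp : 0 < 1 - δ := sub_pos.2 hδ₁
  have hstep : ∀ t : ℕ, 1 ≤ t →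
      (t : ℝ) ^ (-δ) ≤ 1 / (1 - δ) * ((t : ℝ) ^ (1 - δ) - ((t : ℝ) - 1) ^ (1 - δ)) := fun t ht => by
    have h := sub_one_rpow_le (x := t) (by exact_mod_cast ht) hp.le (by linarith)
    rw [show 1 - δ - 1 = -δ by ring] at h
    rw [one_div_mul_eq_div, le_div_iff₀ hp]
    linarith
  induction n with
  | zero =>
    have h1 := hstep T hT
    have h2 : (0 : ℝ) ≤ ((T : ℝ) - 1) ^ (1 - δ) :=
      Real.rpow_nonneg (sub_nonneg.2 (by exact_mod_cast hT)) _
    have h3 : 0 ≤ 1 / (1 - δ) * ((T : ℝ) - 1) ^ (1 - δ) := by positivity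
    simp only [zero_add, Finset.sum_range_one, add_zero]
    linarith
  | succ n ih =>
    rw [Finset.sum_range_succ]
    have h1 := hstep (T + (n + 1)) (by omega)
    have h2 : ((T + (n + 1) : ℕ) : ℝ) - 1 = ((T + n : ℕ) : ℝ) := by push_cast; ring
    rw [h2] at h1
    linarith

lemma sum_rpow_neg_sub_one_le {T : ℕ} (hT : 1 ≤ T) {p : ℝ} (hp₀ : 0 < p) (hp₁ : p ≤ 1) (n : ℕ) :
    ∑ j ∈ Finset.range n, ((T + j : ℕ) : ℝ) ^ (-p - 1) ≤ 2 / p * (T : ℝ) ^ (-p) := by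
  have hstep : ∀ t : ℕ, 1 ≤ t →
      (t : ℝ) ^ (-p - 1) ≤ 2 / p * ((t : ℝ) ^ (-p) - ((t + 1 : ℕ) : ℝ) ^ (-p)) := fun t ht => by
    have hx : (1 : ℝ) ≤ t := by exact_mod_cast ht
    have hx0 : (0 : ℝ) < t := by linarith
    have h := sub_one_rpow_le (x := t + 1) (by linarith) hp₀.le hp₁
    rw [add_sub_cancel_right, Real.rpow_sub_one (by positivity)] at h
    push_cast
    rw [Real.rpow_sub_one hx0.ne', Real.rpow_neg hx0.le, Real.rpow_neg (by positivity),
      div_mul_eq_mul_div, le_div_iff₀ hp₀, inv_sub_inv (by positivity) (by positivity)]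
    have h1 : ((t : ℝ) + 1) ^ p * (p / (t + 1)) ≤ (t + 1) ^ p - t ^ p := by
      rw [mul_div_assoc', mul_comm _ p, ← mul_div_assoc']
      linarith
    have h2 : p / (2 * t) ≤ p / (t + 1) := by gcongr; linarith
    calc ((t : ℝ) ^ p)⁻¹ / t * p
        = 2 * ((t + 1) ^ p * (p / (2 * t)) / (t ^ p * (t + 1) ^ p)) := by field_simp
      _ ≤ _ := by
        gcongr
        exact (mul_le_mul_of_nonneg_left h2 (by positivity)).trans h1
  have hsum : ∑ j ∈ Finset.range n, ((T + j : ℕ) : ℝ) ^ (-p - 1)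
      ≤ 2 / p * ((T : ℝ) ^ (-p) - ((T + n : ℕ) : ℝ) ^ (-p)) := by
    induction n with
    | zero => simp
    | succ n ih =>
      rw [Finset.sum_range_succ]
      have h1 := hstep (T + n) (by omega)
      rw [← add_assoc T n 1]
      linarith
  refine hsum.trans ?_
  gcongr
  have : (0 : ℝ) ≤ ((T + n : ℕ) : ℝ) ^ (-p) := by positivity
  linarith

end Power

section Trajectory

variable {dW dL dX : ℕ} {Ω : Type*} {mΩ : MeasurableSpace Ω} {K : Kernel (Wsp dW) (Wsp dW)}
  [IsMarkovKernel K] {P : Measure Ω} [IsProbabilityMeasure P] {Wp : ℕ → Ω → Wsp dW} {w : Wsp dW}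
  {ν : Measure (Wsp dW)} [IsProbabilityMeasure ν]
  {G : Wsp dW → EuclideanSpace ℝ (Fin dL) → EuclideanSpace ℝ (Fin dX) → EuclideanSpace ℝ (Fin dL)}
  {H : Wsp dW → EuclideanSpace ℝ (Fin dX) → EuclideanSpace ℝ (Fin dX)}
  {lamStar : EuclideanSpace ℝ (Fin dL)} {xiStar : EuclideanSpace ℝ (Fin dX)} {B L ζ ψ : ℝ}
  {xi0 : EuclideanSpace ℝ (Fin dX)} {c₁ ρ β₀ δ : ℝ}

lemma rpow_weight_bounds {t : ℕ} (ht : 1 ≤ t) {γ : ℝ} (hγ₁ : γ ≤ 1) (hβ₀ : 0 < β₀) :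
    ((t + 1 : ℕ) : ℝ) ^ γ * (β₀ * (t : ℝ) ^ (-δ)) ≤ 2 * β₀ * (t : ℝ) ^ (γ - δ) ∧
    ((t + 1 : ℕ) : ℝ) ^ γ * (β₀ * (t : ℝ) ^ (-δ)) ^ 2 ≤ 2 * β₀ ^ 2 * (t : ℝ) ^ (γ - 2 * δ) := by
  have hx : (1 : ℝ) ≤ t := by exact_mod_cast ht
  have hx0 : (0 : ℝ) < t := by linarith
  have h := add_one_rpow_le_two_mul hx hγ₁
  have h1 : (t : ℝ) ^ (γ - δ) = t ^ γ * t ^ (-δ) := by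
    rw [← Real.rpow_add hx0, sub_eq_add_neg]
  have h2 : (t : ℝ) ^ (γ - 2 * δ) = t ^ γ * (t ^ (-δ)) ^ 2 := by
    rw [pow_two, ← Real.rpow_add hx0, ← Real.rpow_add hx0]
    congr 1
    ring
  push_cast
  rw [h1, h2]
  constructor
  · calc ((t : ℝ) + 1) ^ γ * (β₀ * (t : ℝ) ^ (-δ)) ≤ 2 * t ^ γ * (β₀ * (t : ℝ) ^ (-δ)) := by gcongr
      _ = _ := by ring
  · calc ((t : ℝ) + 1) ^ γ * (β₀ * (t : ℝ) ^ (-δ)) ^ 2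
        ≤ 2 * t ^ γ * (β₀ * (t : ℝ) ^ (-δ)) ^ 2 := by gcongr
      _ = _ := by ring

/-- Mean-square rate of the slow iterate. -/
lemma Assumption2.exists_integral_norm_sq_le (hA2 : Assumption2 ν G H lamStar xiStar B L ζ ψ)
    (hc₁ : 0 < c₁) (hρ₀ : 0 ≤ ρ) (hρ₁ : ρ < 1)
    (hU1 : UdBound K ν c₁ ρ 1) (hU2 : UdBound K ν c₁ ρ 2) (hMP : IsMarkovProc K P Wp w)
    (hxi0 : ‖xi0‖ ≤ B) (hβ₀ : 0 < β₀) (hδ₀ : 0 ≤ δ) (hδ₁ : δ < 1) :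
    ∃ C : ℝ, 0 ≤ C ∧ ∃ T₀ : ℕ, ∀ t, T₀ ≤ t →
      ∫ ω, ‖xiSeq H (fun s => β₀ * (s : ℝ) ^ (-δ)) B Wp xi0 t ω - xiStar‖ ^ 2 ∂P
        ≤ C * (t : ℝ) ^ (1 - 2 * δ) := by
  obtain ⟨C₁, hC₁, hbound⟩ := hA2.exists_weighted_bound hc₁ hρ₀ hρ₁ hU1 hU2 hMP hxi0
  obtain ⟨T₁, hT₁⟩ := exists_admissibleWeights_rpow hA2.hψ hβ₀ hδ₁ hδ₀ le_rfl
  set T := max T₁ 1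
  have hT1 : 1 ≤ T := le_max_right _ _
  set E : ℕ → ℝ :=
    fun t => ∫ ω, ‖xiSeq H (fun s => β₀ * (s : ℝ) ^ (-δ)) B Wp xi0 t ω - xiStar‖ ^ 2 ∂P
  have hE0 : ∀ t, 0 ≤ E t := fun t => integral_nonneg fun ω => sq_nonneg _
  have hp : 0 < 1 - δ := sub_pos.2 hδ₁
  set A : ℝ := (T : ℝ) ^ δ * E T + C₁ * (2 * β₀) with hA
  have hA0 : 0 ≤ A := add_nonneg (mul_nonneg (by positivity) (hE0 T)) (by positivity)
  set Q : ℝ := A + C₁ * (2 * β₀ ^ 2 * (1 / (1 - δ))) with hQ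
  have hQ0 : 0 ≤ Q := by positivity
  refine ⟨2 * Q, by positivity, T, fun t ht => ?_⟩
  obtain ⟨n, rfl⟩ := Nat.exists_eq_add_of_le ht
  have hx : (1 : ℝ) ≤ (T + n : ℕ) := by exact_mod_cast hT1.trans ht
  have hx0 : (0 : ℝ) < (T + n : ℕ) := by linarith
  have h := (hbound _ _ T (hT₁ T (le_max_left _ _)) n (Q * ((T + n : ℕ) : ℝ) ^ (1 - δ)) ?_).1
  · have h1 : ((T + n : ℕ) : ℝ) ^ (1 - δ)
        = ((T + n : ℕ) : ℝ) ^ (1 - 2 * δ) * ((T + n : ℕ) : ℝ) ^ δ := by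
      rw [← Real.rpow_add hx0]
      congr 1
      ring
    rw [h1] at h
    have h2 : (0 : ℝ) < ((T + n : ℕ) : ℝ) ^ δ := by positivity
    refine le_of_mul_le_mul_right ?_ h2
    linarith
  · have hb := (rpow_weight_bounds (δ := δ) hT1 hδ₁.le hβ₀).1
    rw [sub_self, Real.rpow_zero, mul_one] at hb
    have hs : ∑ j ∈ Finset.range (n + 1), ((T + j + 1 : ℕ) : ℝ) ^ δ
        * (β₀ * ((T + j : ℕ) : ℝ) ^ (-δ)) ^ 2
        ≤ 2 * β₀ ^ 2 * (1 / (1 - δ) * ((T + n : ℕ) : ℝ) ^ (1 - δ)) := by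
      refine le_trans (Finset.sum_le_sum fun j _ =>
        (rpow_weight_bounds (δ := δ) (t := T + j) (by omega) hδ₁.le hβ₀).2) ?_
      rw [← Finset.mul_sum, show δ - 2 * δ = -δ by ring]
      exact mul_le_mul_of_nonneg_left (sum_rpow_neg_le hT1 hδ₀ hδ₁ n) (by positivity)
    have h1 : 1 ≤ ((T + n : ℕ) : ℝ) ^ (1 - δ) := Real.one_le_rpow hx hp.le
    have h2 := mul_le_mul_of_nonneg_left h1 hA0
    have h3 := mul_le_mul_of_nonneg_left (add_le_add hb hs) hC₁
    rw [hQ]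
    linarith

/-- Trajectory stability of the slow iterate, without a logarithmic factor. -/
lemma Assumption2.exists_trajectory_bound (hA2 : Assumption2 ν G H lamStar xiStar B L ζ ψ)
    (hc₁ : 0 < c₁) (hρ₀ : 0 ≤ ρ) (hρ₁ : ρ < 1)
    (hU1 : UdBound K ν c₁ ρ 1) (hU2 : UdBound K ν c₁ ρ 2) (hMP : IsMarkovProc K P Wp w)
    (hxi0 : ‖xi0‖ ≤ B) (hβ₀ : 0 < β₀) (hδ₁ : δ < 1) {C δc : ℝ} (hC : 0 < C) (hδc₀ : 0 ≤ δc)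
    (hδc₁ : δc < δ - 1 / 2) :
    ∃ Cxi : ℝ, 0 < Cxi ∧ ∃ T₀ : ℕ, ∀ T : ℕ, T₀ ≤ T →
      1 - Cxi * (T : ℝ) ^ (-(2 * δ - 1 - 2 * δc))
        ≤ (P {ω | ∀ t : ℕ, T ≤ t →
            ‖xiSeq H (fun s => β₀ * (s : ℝ) ^ (-δ)) B Wp xi0 t ω - xiStar‖
              ≤ C * (t : ℝ) ^ (-δc)}).toReal := by
  set p : ℝ := 2 * δ - 1 - 2 * δc with hp
  have hp0 : 0 < p := by linarith
  have hp1 : p ≤ 1 := by linarith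
  obtain ⟨C₁, hC₁, hbound⟩ := hA2.exists_weighted_bound hc₁ hρ₀ hρ₁ hU1 hU2 hMP hxi0
  obtain ⟨C₂, hC₂, T₂, hT₂⟩ := hA2.exists_integral_norm_sq_le hc₁ hρ₀ hρ₁ hU1 hU2 hMP hxi0 hβ₀
    (by linarith) hδ₁
  obtain ⟨T₁, hT₁⟩ := exists_admissibleWeights_rpow hA2.hψ hβ₀ hδ₁
    (show 0 ≤ 2 * δc by linarith) (show 2 * δc ≤ δ by linarith)
  set X : ℕ → Ω → EuclideanSpace ℝ (Fin dX) :=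
    xiSeq H (fun s => β₀ * (s : ℝ) ^ (-δ)) B Wp xi0
  set Q : ℝ := C₂ + C₁ * (2 * β₀ + 2 * β₀ ^ 2 * (2 / p)) with hQ
  have hQ0 : 0 ≤ Q := by positivity
  set ε : ℝ := 1 / 2 * C ^ 2 with hε
  have hε0 : 0 < ε := by positivity
  refine ⟨Q / ε + 1, by positivity, max (max T₁ T₂) 1, fun T hT => ?_⟩
  have hT1 : 1 ≤ T := (le_max_right _ _).trans hT
  have hx : (1 : ℝ) ≤ T := by exact_mod_cast hT1
  have hx0 : (0 : ℝ) < T := by linarith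
  have hR : ∀ n, (T : ℝ) ^ (2 * δc) * ∫ ω, ‖X T ω - xiStar‖ ^ 2 ∂P
      + C₁ * (((T + 1 : ℕ) : ℝ) ^ (2 * δc) * (β₀ * (T : ℝ) ^ (-δ))
        + ∑ j ∈ Finset.range (n + 1), ((T + j + 1 : ℕ) : ℝ) ^ (2 * δc)
          * (β₀ * ((T + j : ℕ) : ℝ) ^ (-δ)) ^ 2) ≤ Q * (T : ℝ) ^ (-p) := fun n => by
    have h1 : (T : ℝ) ^ (2 * δc) * ∫ ω, ‖X T ω - xiStar‖ ^ 2 ∂P ≤ C₂ * (T : ℝ) ^ (-p) := by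
      have h := mul_le_mul_of_nonneg_left
        (hT₂ T (((le_max_right _ _).trans (le_max_left _ _)).trans hT))
        (show (0 : ℝ) ≤ (T : ℝ) ^ (2 * δc) by positivity)
      refine h.trans_eq ?_
      rw [mul_left_comm, ← Real.rpow_add hx0, hp]
      congr 2
      ring
    have h2 : ((T + 1 : ℕ) : ℝ) ^ (2 * δc) * (β₀ * (T : ℝ) ^ (-δ))
        ≤ 2 * β₀ * (T : ℝ) ^ (-p) := by
      refine (rpow_weight_bounds (δ := δ) hT1 (by linarith) hβ₀).1.trans ?_
      gcongr
      linarith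
    have h3 : ∑ j ∈ Finset.range (n + 1), ((T + j + 1 : ℕ) : ℝ) ^ (2 * δc)
        * (β₀ * ((T + j : ℕ) : ℝ) ^ (-δ)) ^ 2 ≤ 2 * β₀ ^ 2 * (2 / p * (T : ℝ) ^ (-p)) := by
      refine le_trans (Finset.sum_le_sum fun j _ =>
        (rpow_weight_bounds (δ := δ) (t := T + j) (by omega) (by linarith) hβ₀).2) ?_
      rw [← Finset.mul_sum, show 2 * δc - 2 * δ = -p - 1 by rw [hp]; ring]
      exact mul_le_mul_of_nonneg_left (sum_rpow_neg_sub_one_le hT1 hp0 hp1 _) (by positivity)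
    have h4 := mul_le_mul_of_nonneg_left (add_le_add h2 h3) hC₁
    rw [hQ]
    linarith
  let bad : ℕ → Set Ω := fun n => {ω | ∃ k ≤ n,
    ε ≤ 1 / 2 * ((T + k : ℕ) : ℝ) ^ (2 * δc) * ‖X (T + k) ω - xiStar‖ ^ 2}
  have hbad : ∀ n, P (bad n) ≤ ENNReal.ofReal (Q * (T : ℝ) ^ (-p) / ε) := fun n =>
    (hbound _ _ T (hT₁ T (((le_max_left _ _).trans (le_max_left _ _)).trans hT)) n _ (hR n)).2 ε hε0
  have hmono : Monotone bad := fun m n hmn ω ⟨k, hk, h⟩ => ⟨k, hk.trans hmn, h⟩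
  have hunion : P (⋃ n, bad n) ≤ ENNReal.ofReal (Q * (T : ℝ) ^ (-p) / ε) :=
    le_of_tendsto' (tendsto_measure_iUnion_atTop hmono) hbad
  set good : Set Ω := {ω | ∀ t : ℕ, T ≤ t → ‖X t ω - xiStar‖ ≤ C * (t : ℝ) ^ (-δc)} with hgood
  have hcover : Set.univ ⊆ good ∪ ⋃ n, bad n := fun ω _ => by
    by_contra hω
    rw [Set.mem_union, not_or, Set.mem_iUnion, not_exists] at hω
    refine hω.1 fun t ht => ?_
    obtain ⟨k, rfl⟩ := Nat.exists_eq_add_of_le ht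
    by_contra! hlt
    refine hω.2 k ⟨k, le_rfl, ?_⟩
    have ht0 : (0 : ℝ) < (T + k : ℕ) := by exact_mod_cast (by omega : 0 < T + k)
    have h1 : C ^ 2 ≤ (((T + k : ℕ) : ℝ) ^ δc * ‖X (T + k) ω - xiStar‖) ^ 2 := by
      rw [Real.rpow_neg ht0.le, ← div_eq_mul_inv, div_lt_iff₀' (by positivity)] at hlt
      gcongr
    rw [mul_pow, ← Real.rpow_mul_natCast ht0.le, Nat.cast_ofNat, mul_comm δc] at h1
    rw [hε]
    linarith
  have hone : 1 ≤ P good + ENNReal.ofReal (Q * (T : ℝ) ^ (-p) / ε) := by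
    rw [← measure_univ (μ := P)]
    exact (measure_mono hcover).trans ((measure_union_le _ _).trans (by gcongr))
  have hreal := ENNReal.toReal_mono (by finiteness) hone
  rw [ENNReal.toReal_one, ENNReal.toReal_add (measure_ne_top _ _) ENNReal.ofReal_ne_top,
    ENNReal.toReal_ofReal (by positivity)] at hreal
  have hTp : (0 : ℝ) ≤ (T : ℝ) ^ (-p) := by positivity
  rw [mul_div_right_comm] at hreal
  linarith

end Trajectory

/-- Theorem 1(ii): finite-time trajectory stability bound for the slow iterate. -/
theorem theorem1_ii
    {dW dL dX : ℕ} {Ω : Type*} [MeasurableSpace Ω]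
    (K : Kernel (Wsp dW) (Wsp dW)) [IsMarkovKernel K]
    (ν : Measure (Wsp dW)) [IsProbabilityMeasure ν]
    (hstat : ν.bind (⇑K) = ν)
    (c₁ ρ : ℝ) (hc₁ : 0 < c₁) (hρ₀ : 0 ≤ ρ) (hρ₁ : ρ < 1)
    (hU1 : UdBound K ν c₁ ρ 1) (hU2 : UdBound K ν c₁ ρ 2)
    (G : Wsp dW → EuclideanSpace ℝ (Fin dL) → EuclideanSpace ℝ (Fin dX) →
      EuclideanSpace ℝ (Fin dL))
    (H : Wsp dW → EuclideanSpace ℝ (Fin dX) → EuclideanSpace ℝ (Fin dX))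
    (lamStar : EuclideanSpace ℝ (Fin dL)) (xiStar : EuclideanSpace ℝ (Fin dX))
    (B L ζ ψ : ℝ)
    (hA2 : Assumption2 ν G H lamStar xiStar B L ζ ψ)
    (α₀ β₀ κ δ : ℝ) (hα₀ : 0 < α₀) (hβ₀ : 0 < β₀)
    (hκlow : 1/2 < κ) (hκδ : κ ≤ δ) (hδhigh : δ < 1)
    (P : Measure Ω) [IsProbabilityMeasure P]
    (Wp : ℕ → Ω → Wsp dW) (w : Wsp dW)
    (hMP : IsMarkovProc K P Wp w)
    (lam0 : EuclideanSpace ℝ (Fin dL)) (xi0 : EuclideanSpace ℝ (Fin dX))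
    (hlam0 : ‖lam0‖ ≤ B) (hxi0 : ‖xi0‖ ≤ B)
    (C δc : ℝ) (hC : 0 < C) (hδc0 : 0 ≤ δc) (hδc1 : δc < δ - 1/2) :
    (∃ Cxi : ℝ, 0 < Cxi ∧ ∃ T₀ : ℕ, ∀ T : ℕ, T₀ ≤ T →
        1 - Cxi * (T : ℝ) ^ (-(2 * δ - 1 - 2 * δc)) * Real.log T
          ≤ (P {ω | ∀ t : ℕ, T ≤ t →
              ‖xiSeq H (fun s => β₀ * (s : ℝ) ^ (-δ)) B Wp xi0 t ω - xiStar‖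
                ≤ C * (t : ℝ) ^ (-δc)}).toReal) ∧
    ((∀ w', K w' = ν) →
      ∃ Cxi : ℝ, 0 < Cxi ∧ ∃ T₀ : ℕ, ∀ T : ℕ, T₀ ≤ T →
        1 - Cxi * (T : ℝ) ^ (-(2 * δ - 1 - 2 * δc))
          ≤ (P {ω | ∀ t : ℕ, T ≤ t →
              ‖xiSeq H (fun s => β₀ * (s : ℝ) ^ (-δ)) B Wp xi0 t ω - xiStar‖
                ≤ C * (t : ℝ) ^ (-δc)}).toReal) := by
  obtain ⟨Cxi, hCxi, T₀, hT₀⟩ := hA2.exists_trajectory_bound hc₁ hρ₀ hρ₁ hU1 hU2 hMP hxi0 hβ₀ hδhigh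
    hC hδc0 hδc1
  refine ⟨⟨Cxi, hCxi, max T₀ 3, fun T hT => ?_⟩, fun _ => ⟨Cxi, hCxi, T₀, hT₀⟩⟩
  refine le_trans ?_ (hT₀ T ((le_max_left _ _).trans hT))
  have hT3 : (3 : ℝ) ≤ T := by exact_mod_cast (le_max_right _ _).trans hT
  have hlog : 1 ≤ Real.log T := by
    rw [Real.le_log_iff_exp_le (by linarith)]
    linarith [Real.exp_one_lt_d9]
  have h := le_mul_of_one_le_right
    (show 0 ≤ Cxi * (T : ℝ) ^ (-(2 * δ - 1 - 2 * δc)) by positivity) hlog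
  linarith

end
end

section
/- Discrete Gronwall-type decay for the Lyapunov recursion (Lemma A.6). Let κ ∈ (0,1), k₀ > 0, k̃₁ ≥ 0, and k̃₂ > 0, and let (a_t)_{t≥1} and (g_t)_{t≥1} be sequences of nonnegative real numbers. For each t set f_t := max(a_t, g_t). Suppose there is an integer T₀ ≥ 1 such that for all t ≥ T₀: a_{t+1} ≤ (1 − k₀·t^{−κ})·f_t + (k̃₁·ln t + k̃₂)·t^{−2κ} and g_t ≤ (k̃₁·ln t + k̃₂)·t^{−κ}. Then there exist constants k₃ > 0 and k₄ > 0 and an integer T₁ such that for all t ≥ T₁: a_t ≤ k₃·exp(−k₀·t^{1−κ}/(1−κ)) + k₄·(k̃₁·ln t + k̃₂)·t^{−κ}. -/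
/-- The exponential `exp (-k₀ x ^ (1 - κ) / (1 - κ))` is a supersolution of the linear recursion
`u (x + 1) = (1 - k₀ x ^ (-κ)) u x`. -/
lemma one_sub_mul_exp_neg_rpow_le {κ k₀ x : ℝ} (hκ0 : 0 < κ) (hκ1 : κ < 1) (hk₀ : 0 < k₀)
    (hx : 0 < x) :
    (1 - k₀ * x ^ (-κ)) * Real.exp (-(k₀ * x ^ (1 - κ)) / (1 - κ)) ≤
      Real.exp (-(k₀ * (x + 1) ^ (1 - κ)) / (1 - κ)) := by
  have hκ : 0 < 1 - κ := by linarith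
  have hbern : (x + 1) ^ (1 - κ) ≤ x ^ (1 - κ) + (1 - κ) * x ^ (-κ) := by
    have hsplit : (x + 1) ^ (1 - κ) = x ^ (1 - κ) * (1 + 1 / x) ^ (1 - κ) := by
      rw [← Real.mul_rpow hx.le (by positivity)]
      congr 1
      field_simp
    have hle : (1 + 1 / x) ^ (1 - κ) ≤ 1 + (1 - κ) * (1 / x) :=
      rpow_one_add_le_one_add_mul_self (by linarith [one_div_pos.2 hx]) hκ.le (by linarith)
    have hpow : x ^ (1 - κ) * (1 / x) = x ^ (-κ) := by
      rw [mul_one_div, ← Real.rpow_sub_one hx.ne']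
      congr 1
      ring
    calc (x + 1) ^ (1 - κ) ≤ x ^ (1 - κ) * (1 + (1 - κ) * (1 / x)) := by
          rw [hsplit]
          gcongr
      _ = x ^ (1 - κ) + (1 - κ) * x ^ (-κ) := by rw [← hpow]; ring
  calc (1 - k₀ * x ^ (-κ)) * Real.exp (-(k₀ * x ^ (1 - κ)) / (1 - κ))
      ≤ Real.exp (-(k₀ * x ^ (-κ))) * Real.exp (-(k₀ * x ^ (1 - κ)) / (1 - κ)) := by
        gcongr
        linarith [Real.add_one_le_exp (-(k₀ * x ^ (-κ)))]
    _ = Real.exp (-(k₀ * (x ^ (1 - κ) + (1 - κ) * x ^ (-κ))) / (1 - κ)) := by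
        rw [← Real.exp_add]
        congr 1
        field_simp
        ring
    _ ≤ Real.exp (-(k₀ * (x + 1) ^ (1 - κ)) / (1 - κ)) := by
        gcongr

lemma one_sub_one_div_mul_rpow_neg_le {κ x : ℝ} (hκ1 : κ < 1) (hx : 0 < x) :
    (1 - 1 / x) * x ^ (-κ) ≤ (x + 1) ^ (-κ) := by
  have hsplit : (x + 1) ^ (-κ) = (1 + 1 / x) ^ (-κ) * x ^ (-κ) := by
    rw [← Real.mul_rpow (by positivity) hx.le]
    congr 1
    field_simp
  rw [hsplit]
  gcongr
  have hone : 1 ≤ 1 + 1 / x := by linarith [one_div_pos.2 hx]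
  calc 1 - 1 / x ≤ (1 + 1 / x) ^ (-1 : ℝ) := by
        rw [Real.rpow_neg_one, ← one_div, le_div_iff₀ (by positivity)]
        nlinarith [sq_nonneg (1 / x)]
    _ ≤ (1 + 1 / x) ^ (-κ) := Real.rpow_le_rpow_of_exponent_le hone (by linarith)

/-- Once `x` is large, `c (k₁ log x + k₂) x ^ (-κ)` is a supersolution of the linear recursion with
forcing term `(k₁ log x + k₂) x ^ (-2κ)`, provided `2 ≤ c k₀`. -/
lemma log_rpow_supersolution {κ k₀ k₁ k₂ c x : ℝ} (hκ1 : κ < 1)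
    (hk₁ : 0 ≤ k₁) (hk₂ : 0 < k₂) (hc : 0 < c) (hck : 2 ≤ c * k₀) (hx : 1 ≤ x)
    (hlarge : 1 / x ≤ k₀ / 2 * x ^ (-κ)) :
    (1 - k₀ * x ^ (-κ)) * (c * ((k₁ * Real.log x + k₂) * x ^ (-κ))) +
        (k₁ * Real.log x + k₂) * x ^ (-(2 * κ)) ≤
      c * ((k₁ * Real.log (x + 1) + k₂) * (x + 1) ^ (-κ)) := by
  have hx0 : 0 < x := by linarith
  have hL : 0 ≤ k₁ * Real.log x + k₂ := by
    have := Real.log_nonneg hx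
    positivity
  have hsq : x ^ (-(2 * κ)) = x ^ (-κ) * x ^ (-κ) := by
    rw [← Real.rpow_add hx0]
    congr 1
    ring
  have hp : 0 < x ^ (-κ) := by positivity
  have hcoef : (1 - k₀ * x ^ (-κ)) * c + x ^ (-κ) ≤ c * (1 - 1 / x) := by
    nlinarith [mul_le_mul_of_nonneg_left hlarge hc.le, mul_le_mul_of_nonneg_right hck hp.le]
  calc (1 - k₀ * x ^ (-κ)) * (c * ((k₁ * Real.log x + k₂) * x ^ (-κ))) +
        (k₁ * Real.log x + k₂) * x ^ (-(2 * κ))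
      = ((1 - k₀ * x ^ (-κ)) * c + x ^ (-κ)) * ((k₁ * Real.log x + k₂) * x ^ (-κ)) := by
        rw [hsq]
        ring
    _ ≤ c * (1 - 1 / x) * ((k₁ * Real.log x + k₂) * x ^ (-κ)) := by gcongr
    _ = c * ((k₁ * Real.log x + k₂) * ((1 - 1 / x) * x ^ (-κ))) := by ring
    _ ≤ c * ((k₁ * Real.log x + k₂) * (x + 1) ^ (-κ)) := by
        gcongr
        exact one_sub_one_div_mul_rpow_neg_le hκ1 hx0
    _ ≤ c * ((k₁ * Real.log (x + 1) + k₂) * (x + 1) ^ (-κ)) := by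
        gcongr
        linarith

/-- Lemma A.6: discrete Gronwall-type decay for the Lyapunov recursion. -/
theorem gronwall_decay
    (κ k₀ k₁ k₂ : ℝ) (hκ0 : 0 < κ) (hκ1 : κ < 1)
    (hk₀ : 0 < k₀) (hk₁ : 0 ≤ k₁) (hk₂ : 0 < k₂)
    (a g : ℕ → ℝ) (ha : ∀ t, 0 ≤ a t) (hg : ∀ t, 0 ≤ g t)
    (T₀ : ℕ) (hT₀ : 1 ≤ T₀)
    (hrec : ∀ t : ℕ, T₀ ≤ t →
      a (t + 1) ≤ (1 - k₀ * (t : ℝ) ^ (-κ)) * max (a t) (g t) +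
        (k₁ * Real.log t + k₂) * (t : ℝ) ^ (-(2 * κ)))
    (hgb : ∀ t : ℕ, T₀ ≤ t → g t ≤ (k₁ * Real.log t + k₂) * (t : ℝ) ^ (-κ)) :
    ∃ k₃ k₄ : ℝ, 0 < k₃ ∧ 0 < k₄ ∧ ∃ T₁ : ℕ, ∀ t : ℕ, T₁ ≤ t →
      a t ≤ k₃ * Real.exp (-(k₀ * (t : ℝ) ^ (1 - κ)) / (1 - κ)) +
        k₄ * ((k₁ * Real.log t + k₂) * (t : ℝ) ^ (-κ)) := by
  have hev : ∀ᶠ x : ℝ in Filter.atTop, k₀ * x ^ (-κ) ≤ 1 ∧ 1 / x ≤ k₀ / 2 * x ^ (-κ) := by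
    filter_upwards [(tendsto_rpow_neg_atTop hκ0).eventually_le_const (one_div_pos.2 hk₀),
      (tendsto_rpow_neg_atTop (sub_pos.2 hκ1)).eventually_le_const (half_pos hk₀),
      Filter.eventually_gt_atTop 0] with x h₁ h₂ hx
    refine ⟨by rwa [le_div_iff₀' hk₀] at h₁, ?_⟩
    calc 1 / x = x ^ (-(1 - κ)) * x ^ (-κ) := by
          rw [← Real.rpow_add hx, one_div, ← Real.rpow_neg_one]
          congr 1
          ring
      _ ≤ k₀ / 2 * x ^ (-κ) := by gcongr
  obtain ⟨N, hN⟩ := Filter.eventually_atTop.1 (tendsto_natCast_atTop_atTop.eventually hev)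
  set T := max N T₀
  set E : ℕ → ℝ := fun t ↦ Real.exp (-(k₀ * (t : ℝ) ^ (1 - κ)) / (1 - κ))
  have hET : 0 < E T := Real.exp_pos _
  have hk₃ : 0 < (a T + 1) / E T := div_pos (by linarith [ha T]) hET
  have hk₄ : 0 < 1 + 2 / k₀ := by positivity
  have hφ : ∀ t : ℕ, T ≤ t → 0 ≤ (k₁ * Real.log t + k₂) * (t : ℝ) ^ (-κ) := fun t ht ↦
    (hg t).trans (hgb t (le_of_max_le_right ht))
  refine ⟨(a T + 1) / E T, 1 + 2 / k₀, hk₃, hk₄, T, fun t ht ↦ ?_⟩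
  induction t, ht using Nat.le_induction with
  | base =>
    have hcancel : (a T + 1) / E T * E T = a T + 1 := div_mul_cancel₀ _ hET.ne'
    have := mul_nonneg hk₄.le (hφ T le_rfl)
    linarith
  | succ t ht ih =>
    have htT₀ : T₀ ≤ t := le_of_max_le_right ht
    have ht1 : (1 : ℝ) ≤ t := by exact_mod_cast hT₀.trans htT₀
    obtain ⟨hcoef, hlarge⟩ := hN t (le_of_max_le_left ht)
    have hgt : g t ≤ (a T + 1) / E T * E t +
        (1 + 2 / k₀) * ((k₁ * Real.log t + k₂) * (t : ℝ) ^ (-κ)) := by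
      have h₁ : 0 ≤ (a T + 1) / E T * E t := mul_nonneg hk₃.le (Real.exp_pos _).le
      have h₂ := mul_nonneg (by positivity : 0 ≤ 2 / k₀) (hφ t ht)
      linarith [hgb t htT₀]
    have hstep := mul_le_mul_of_nonneg_left (max_le ih hgt) (sub_nonneg.2 hcoef)
    have hexp := mul_le_mul_of_nonneg_left
      (one_sub_mul_exp_neg_rpow_le hκ0 hκ1 hk₀ (by linarith : (0 : ℝ) < t)) hk₃.le
    have hck : 2 ≤ (1 + 2 / k₀) * k₀ := by
      have : (1 + 2 / k₀) * k₀ = k₀ + 2 := by field_simp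
      linarith
    have hforce := log_rpow_supersolution hκ1 hk₁ hk₂ hk₄ hck ht1 hlarge
    push_cast
    linarith [hrec t htT₀]
end

section
/- Decay of a recursion with step size 1/t (the case δ = 1 in the proof of Proposition 1(ii)). Let k₀ > 0, k̃₁ ≥ 0, and k̃₂ > 0, and let (x_t)_{t≥1} be a sequence of nonnegative real numbers. Let T ≥ 2 be an integer with T > k₀ such that for all t ≥ T: x_{t+1} ≤ (1 − k₀/t)·x_t + (k̃₁·ln t + k̃₂)/t². Then for all t ≥ T: (a) if 0 < k₀ < 1, then x_t ≤ (T/t)^{k₀}·x_T + (2^{k₀}/(1−k₀))·(k̃₁·ln t + k̃₂)/t^{k₀}; (b) if k₀ = 1, then x_t ≤ (T/t)·x_T + 2·(k̃₁·ln t + k̃₂)·(ln t)/t; (c) if k₀ > 1, then x_t ≤ (T/t)^{k₀}·x_T + (2^{k₀}/(k₀−1))·(k̃₁·ln t + k̃₂)/t. -/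
/-- Multiplying a recursion `x (t+1) ≤ (1 - a/t) x t + c t / t²` by `t ^ a` bounds the solution by
a partial sum of `i ^ (a - 2)`. -/
lemma rpow_mul_le_of_recursion {a : ℝ} (ha : 0 < a) {x c : ℕ → ℝ} (hx : ∀ t, 0 ≤ x t) {T : ℕ}
    (hT : 1 ≤ T) (hc : ∀ t, T ≤ t → 0 ≤ c t) (hmono : ∀ t, T ≤ t → c t ≤ c (t + 1))
    (hrec : ∀ t : ℕ, T ≤ t → x (t + 1) ≤ (1 - a / (t : ℝ)) * x t + c t / (t : ℝ) ^ 2)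
    {t : ℕ} (ht : T ≤ t) :
    (t : ℝ) ^ a * x t ≤
      (T : ℝ) ^ a * x T + 2 ^ a * c t * ∑ i ∈ Finset.Ico T t, (i : ℝ) ^ (a - 2) := by
  induction t, ht using Nat.le_induction with
  | base => simp
  | succ t ht ih =>
    have ht1 : (1 : ℝ) ≤ t := by exact_mod_cast hT.trans ht
    have ht0 : (0 : ℝ) < t := by linarith
    have hsplit : ((t + 1 : ℕ) : ℝ) = t * (1 + 1 / t) := by push_cast; field_simp
    have hpow : ((t + 1 : ℕ) : ℝ) ^ a = (t : ℝ) ^ a * (1 + 1 / t) ^ a := by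
      rw [hsplit, Real.mul_rpow ht0.le (by positivity)]
    have hcontr : ((t + 1 : ℕ) : ℝ) ^ a * (1 - a / t) ≤ (t : ℝ) ^ a := by
      have h1 : (1 + 1 / (t : ℝ)) ^ a ≤ Real.exp (a / t) := by
        calc (1 + 1 / (t : ℝ)) ^ a ≤ Real.exp (1 / t) ^ a := by
              gcongr
              linarith [Real.add_one_le_exp (1 / (t : ℝ))]
          _ = Real.exp (a / t) := by rw [← Real.exp_mul]; congr 1; ring
      have h2 : 1 - a / (t : ℝ) ≤ Real.exp (-(a / t)) := Real.one_sub_le_exp_neg _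
      have h3 : (1 + 1 / (t : ℝ)) ^ a * (1 - a / t) ≤ 1 := by
        calc (1 + 1 / (t : ℝ)) ^ a * (1 - a / t)
            ≤ (1 + 1 / (t : ℝ)) ^ a * Real.exp (-(a / t)) := by gcongr
          _ ≤ Real.exp (a / t) * Real.exp (-(a / t)) := by gcongr
          _ = 1 := by rw [← Real.exp_add]; simp
      rw [hpow, mul_assoc]
      exact mul_le_of_le_one_right (by positivity) h3
    have hnoise : ((t + 1 : ℕ) : ℝ) ^ a / (t : ℝ) ^ 2 ≤ 2 ^ a * (t : ℝ) ^ (a - 2) := by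
      rw [Real.rpow_sub ht0, Real.rpow_two, ← mul_div_assoc,
        ← Real.mul_rpow (by norm_num) ht0.le]
      gcongr
      push_cast
      linarith
    rw [Finset.sum_Ico_succ_top ht]
    have hS : 0 ≤ ∑ i ∈ Finset.Ico T t, (i : ℝ) ^ (a - 2) :=
      Finset.sum_nonneg fun i _ => by positivity
    have hct := hc t ht
    calc ((t + 1 : ℕ) : ℝ) ^ a * x (t + 1)
        ≤ ((t + 1 : ℕ) : ℝ) ^ a * ((1 - a / (t : ℝ)) * x t + c t / (t : ℝ) ^ 2) := by
          gcongr
          exact hrec t ht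
      _ = ((t + 1 : ℕ) : ℝ) ^ a * (1 - a / (t : ℝ)) * x t
            + ((t + 1 : ℕ) : ℝ) ^ a / (t : ℝ) ^ 2 * c t := by ring
      _ ≤ (t : ℝ) ^ a * x t + 2 ^ a * (t : ℝ) ^ (a - 2) * c t := by
          have := hx t
          gcongr
      _ ≤ (T : ℝ) ^ a * x T + 2 ^ a * c t * ∑ i ∈ Finset.Ico T t, (i : ℝ) ^ (a - 2)
            + 2 ^ a * (t : ℝ) ^ (a - 2) * c t := by gcongr
      _ = (T : ℝ) ^ a * x T
            + 2 ^ a * c t * (∑ i ∈ Finset.Ico T t, (i : ℝ) ^ (a - 2) + (t : ℝ) ^ (a - 2)) := by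
          ring
      _ ≤ _ := by
          gcongr
          exact hmono t ht

lemma sum_Ico_le_sub_of_le_sub {f G : ℕ → ℝ} {T : ℕ}
    (h : ∀ i, T ≤ i → f i ≤ G (i + 1) - G i) {t : ℕ} (ht : T ≤ t) :
    ∑ i ∈ Finset.Ico T t, f i ≤ G t - G T := by
  rw [← Finset.sum_Ico_sub _ ht]
  exact Finset.sum_le_sum fun i hi => h i (Finset.mem_Ico.1 hi).1

lemma mul_rpow_sub_one_le_rpow_add_one_sub {b y : ℝ} (hb : 1 ≤ b) (hy : 0 < y) :
    b * y ^ (b - 1) ≤ (y + 1) ^ b - y ^ b := by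
  have h := one_add_mul_self_le_rpow_one_add (s := 1 / y)
    (by linarith [one_div_pos.2 hy]) hb
  have hs : (y + 1) ^ b = y ^ b * (1 + 1 / y) ^ b := by
    rw [← Real.mul_rpow hy.le (by positivity)]
    congr 1
    field_simp
  have := mul_le_mul_of_nonneg_left h (Real.rpow_nonneg hy.le b)
  rw [Real.rpow_sub_one hy.ne', hs]
  linear_combination this

lemma mul_rpow_sub_one_le_rpow_sub_rpow_sub_one {b y : ℝ} (hb0 : 0 ≤ b) (hb : b ≤ 1)
    (hy : 1 ≤ y) : b * y ^ (b - 1) ≤ y ^ b - (y - 1) ^ b := by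
  have hy0 : 0 < y := by linarith
  have h1 : 1 / y ≤ 1 := (div_le_one hy0).2 hy
  have h := rpow_one_add_le_one_add_mul_self (s := -(1 / y)) (by linarith) hb0 hb
  have hs : (y - 1) ^ b = y ^ b * (1 + -(1 / y)) ^ b := by
    rw [← Real.mul_rpow hy0.le (by linarith)]
    congr 1
    field_simp
    ring
  have := mul_le_mul_of_nonneg_left h (Real.rpow_nonneg hy0.le b)
  rw [Real.rpow_sub_one hy0.ne', hs]
  linear_combination this

lemma neg_mul_rpow_sub_one_le_rpow_sub_one_sub {b y : ℝ} (hb : b ≤ 0) (hy : 1 < y) :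
    -b * y ^ (b - 1) ≤ (y - 1) ^ b - y ^ b := by
  have hy0 : 0 < y := by linarith
  have h1 : 1 / y < 1 := (div_lt_one hy0).2 hy
  have h : 1 - b / y ≤ (1 - 1 / y) ^ b := by
    calc 1 - b / y ≤ Real.exp (-(b / y)) := Real.one_sub_le_exp_neg _
      _ = Real.exp (-(1 / y)) ^ b := by rw [← Real.exp_mul]; congr 1; ring
      _ ≤ (1 - 1 / y) ^ b :=
          Real.rpow_le_rpow_of_nonpos (by linarith) (Real.one_sub_le_exp_neg _) hb
  have hs : (y - 1) ^ b = y ^ b * (1 - 1 / y) ^ b := by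
    rw [← Real.mul_rpow hy0.le (by linarith)]
    congr 1
    field_simp
  have := mul_le_mul_of_nonneg_left h (Real.rpow_nonneg hy0.le b)
  rw [Real.rpow_sub_one hy0.ne', hs]
  linear_combination this

lemma sum_Ico_rpow_le_of_lt_one {a : ℝ} (ha : a < 1) {T t : ℕ} (hT : 2 ≤ T) (ht : T ≤ t) :
    ∑ i ∈ Finset.Ico T t, (i : ℝ) ^ (a - 2) ≤ 1 / (1 - a) := by
  have hT' : (2 : ℝ) ≤ T := by exact_mod_cast hT
  have ht' : (T : ℝ) ≤ t := by exact_mod_cast ht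
  have h := sum_Ico_le_sub_of_le_sub (f := fun i => (1 - a) * (i : ℝ) ^ (a - 2))
    (G := fun i => -((i : ℝ) - 1) ^ (a - 1)) (T := T) (fun i hi => by
      have hi' : (T : ℝ) ≤ i := by exact_mod_cast hi
      have := neg_mul_rpow_sub_one_le_rpow_sub_one_sub (b := a - 1) (y := i)
        (by linarith) (by linarith)
      rw [show a - 1 - 1 = a - 2 by ring] at this
      push_cast
      rw [add_sub_cancel_right]
      linarith) ht
  rw [← Finset.mul_sum] at h
  have h1 : ((T : ℝ) - 1) ^ (a - 1) ≤ 1 :=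
    Real.rpow_le_one_of_one_le_of_nonpos (by linarith) (by linarith)
  have h2 : 0 ≤ ((t : ℝ) - 1) ^ (a - 1) := Real.rpow_nonneg (by linarith) _
  rw [le_div_iff₀ (by linarith), mul_comm]
  linarith

lemma sum_Ico_rpow_neg_one_le_log {T t : ℕ} (hT : 2 ≤ T) (ht : T ≤ t) :
    ∑ i ∈ Finset.Ico T t, (i : ℝ) ^ (-1 : ℝ) ≤ Real.log t := by
  have hT' : (2 : ℝ) ≤ T := by exact_mod_cast hT
  have ht' : (T : ℝ) ≤ t := by exact_mod_cast ht
  have h := sum_Ico_le_sub_of_le_sub (f := fun i => (i : ℝ) ^ (-1 : ℝ))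
    (G := fun i => Real.log ((i : ℝ) - 1)) (T := T) (fun i hi => by
      have hi' : (T : ℝ) ≤ i := by exact_mod_cast hi
      have hi0 : (0 : ℝ) < i := by linarith
      have hi1 : (0 : ℝ) < i - 1 := by linarith
      have := Real.log_le_sub_one_of_pos (div_pos hi1 hi0)
      rw [Real.log_div hi1.ne' hi0.ne', sub_div, div_self hi0.ne', one_div] at this
      push_cast
      rw [add_sub_cancel_right, Real.rpow_neg_one]
      linarith) ht
  have h1 : 0 ≤ Real.log ((T : ℝ) - 1) := Real.log_nonneg (by linarith)
  have h2 : Real.log ((t : ℝ) - 1) ≤ Real.log t := Real.log_le_log (by linarith) (by linarith)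
  linarith

lemma sum_Ico_rpow_le_of_one_lt {a : ℝ} (ha : 1 < a) {T t : ℕ} (hT : 1 ≤ T) (ht : T ≤ t) :
    ∑ i ∈ Finset.Ico T t, (i : ℝ) ^ (a - 2) ≤ (t : ℝ) ^ (a - 1) / (a - 1) := by
  have hT' : (1 : ℝ) ≤ T := by exact_mod_cast hT
  have ht' : (T : ℝ) ≤ t := by exact_mod_cast ht
  have hexp : a - 1 - 1 = a - 2 := by ring
  rw [le_div_iff₀ (by linarith), mul_comm, Finset.mul_sum]
  rcases le_total 2 a with h2 | h2
  · have h := sum_Ico_le_sub_of_le_sub (f := fun i => (a - 1) * (i : ℝ) ^ (a - 2))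
      (G := fun i => (i : ℝ) ^ (a - 1)) (T := T) (fun i hi => by
        have hi' : (T : ℝ) ≤ i := by exact_mod_cast hi
        have := mul_rpow_sub_one_le_rpow_add_one_sub (b := a - 1) (y := i)
          (by linarith) (by linarith)
        rw [hexp] at this
        push_cast
        exact this) ht
    have : 0 ≤ (T : ℝ) ^ (a - 1) := by positivity
    linarith
  · have h := sum_Ico_le_sub_of_le_sub (f := fun i => (a - 1) * (i : ℝ) ^ (a - 2))
      (G := fun i => ((i : ℝ) - 1) ^ (a - 1)) (T := T) (fun i hi => by
        have hi' : (T : ℝ) ≤ i := by exact_mod_cast hi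
        have := mul_rpow_sub_one_le_rpow_sub_rpow_sub_one (b := a - 1) (y := i)
          (by linarith) (by linarith) (by linarith)
        rw [hexp] at this
        push_cast
        rw [add_sub_cancel_right]
        exact this) ht
    have h3 : 0 ≤ ((T : ℝ) - 1) ^ (a - 1) := Real.rpow_nonneg (by linarith) _
    have h4 : ((t : ℝ) - 1) ^ (a - 1) ≤ (t : ℝ) ^ (a - 1) :=
      Real.rpow_le_rpow (by linarith) (by linarith) (by linarith)
    linarith


/-- Decay of a recursion with step size `1/t` (the case `δ = 1` in the proof of
Proposition 1(ii)). -/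
theorem recursion_decay_delta_one
    (k₀ k₁ k₂ : ℝ) (hk₀ : 0 < k₀) (hk₁ : 0 ≤ k₁) (hk₂ : 0 < k₂)
    (x : ℕ → ℝ) (hx : ∀ t, 0 ≤ x t)
    (T : ℕ) (hT : 2 ≤ T) (hTk : k₀ < (T : ℝ))
    (hrec : ∀ t : ℕ, T ≤ t →
      x (t + 1) ≤ (1 - k₀ / (t : ℝ)) * x t + (k₁ * Real.log t + k₂) / (t : ℝ) ^ 2) :
    ∀ t : ℕ, T ≤ t →
      (k₀ < 1 →
        x t ≤ ((T : ℝ) / t) ^ k₀ * x T +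
          (2 ^ k₀ / (1 - k₀)) * (k₁ * Real.log t + k₂) / (t : ℝ) ^ k₀) ∧
      (k₀ = 1 →
        x t ≤ ((T : ℝ) / t) * x T +
          2 * (k₁ * Real.log t + k₂) * Real.log t / t) ∧
      (1 < k₀ →
        x t ≤ ((T : ℝ) / t) ^ k₀ * x T +
          (2 ^ k₀ / (k₀ - 1)) * (k₁ * Real.log t + k₂) / t) := by
  intro t ht
  have hT0 : (2 : ℝ) ≤ T := by exact_mod_cast hT
  have htT : (T : ℝ) ≤ t := by exact_mod_cast ht
  have ht0 : (0 : ℝ) < t := by linarith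
  have hc : ∀ s : ℕ, T ≤ s → 0 ≤ k₁ * Real.log s + k₂ := fun s _ => by
    have := Real.log_natCast_nonneg s
    positivity
  have hmono : ∀ s : ℕ, T ≤ s →
      k₁ * Real.log s + k₂ ≤ k₁ * Real.log ((s + 1 : ℕ) : ℝ) + k₂ := fun s hs => by
    have : (0 : ℝ) < s := by exact_mod_cast (show 0 < s by omega)
    gcongr
    omega
  have hmain : ∀ B, ∑ i ∈ Finset.Ico T t, (i : ℝ) ^ (k₀ - 2) ≤ B →
      x t ≤ ((T : ℝ) / t) ^ k₀ * x T + 2 ^ k₀ * (k₁ * Real.log t + k₂) * B / (t : ℝ) ^ k₀ := by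
    intro B hB
    have h := rpow_mul_le_of_recursion hk₀ hx (by omega) hc hmono hrec ht
    have hct := hc t ht
    have htk : 0 < (t : ℝ) ^ k₀ := by positivity
    rw [Real.div_rpow (by positivity) ht0.le, div_mul_eq_mul_div, ← add_div, le_div_iff₀ htk,
      mul_comm]
    refine h.trans ?_
    gcongr
  refine ⟨fun hk => ?_, fun hk => ?_, fun hk => ?_⟩
  · refine (hmain _ (sum_Ico_rpow_le_of_lt_one hk hT ht)).trans_eq ?_
    ring
  · subst hk
    have h := hmain (Real.log t)
      (by rw [show (1 : ℝ) - 2 = -1 by norm_num]; exact sum_Ico_rpow_neg_one_le_log hT ht)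
    simpa only [Real.rpow_one] using h
  · refine (hmain _ (sum_Ico_rpow_le_of_one_lt hk (by omega) ht)).trans_eq ?_
    rw [Real.rpow_sub_one ht0.ne']
    have : k₀ - 1 ≠ 0 := by linarith
    have : (t : ℝ) ^ k₀ ≠ 0 := by positivity
    field_simp
end

section
/- Geometric-weight summation bound (Lemma B.1). For every C > 0, every δ̃ ∈ (0,1), and every a ∈ [0,4], there exists an integer T such that for all integers t ≥ T: Σ_{m=1}^{t} exp(−C·(t−m)·t^{−δ̃})·m^{−a} ≤ (2/C)·t^{δ̃−a}. Consequently, for any family of real numbers (Q̃_{t,m})_{1≤m≤t} with 0 < Q̃_{t,m} ≤ exp(−C·(t−m)·t^{−δ̃}), one has Σ_{m=1}^{t} Q̃_{t,m}·m^{−a} ≤ (2/C)·t^{δ̃−a} for all t ≥ T. -/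
/-- Concavity of the logarithm along the chord from `1` to `t`. -/
lemma log_sub_log_le_chord {t m : ℝ} (hm : 1 ≤ m) (hmt : m ≤ t) (ht : 1 < t) :
    Real.log t - Real.log m ≤ Real.log t / (t - 1) * (t - m) := by
  have ht1 : 0 < t - 1 := by linarith
  have hweights : (t - m) / (t - 1) + (m - 1) / (t - 1) = 1 := by field_simp; ring
  have h := strictConcaveOn_log_Ioi.concaveOn.2 (Set.mem_Ioi.2 one_pos)
    (Set.mem_Ioi.2 (by linarith : 0 < t)) (div_nonneg (by linarith) ht1.le)
    (div_nonneg (by linarith) ht1.le) hweights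
  have hcomb : (t - m) / (t - 1) * 1 + (m - 1) / (t - 1) * t = m := by field_simp; ring
  simp only [smul_eq_mul, hcomb, Real.log_one, mul_zero, zero_add] at h
  have hsplit : Real.log t / (t - 1) * (t - m)
      = Real.log t - (m - 1) / (t - 1) * Real.log t := by field_simp; ring
  linarith

/-- A finite geometric sum with ratio `exp (-y)` is at most `1 + 1 / y`. -/
lemma sum_exp_neg_mul_sub_le {y : ℝ} (hy : 0 < y) (t : ℕ) :
    ∑ m ∈ Finset.Icc 1 t, Real.exp (-y * ((t : ℝ) - m)) ≤ 1 + 1 / y := by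
  induction t with
  | zero => simp; positivity
  | succ t ih =>
    rw [Finset.sum_Icc_succ_top (by omega)]
    have hstep : ∑ m ∈ Finset.Icc 1 t, Real.exp (-y * (((t + 1 : ℕ) : ℝ) - m))
        = Real.exp (-y) * ∑ m ∈ Finset.Icc 1 t, Real.exp (-y * ((t : ℝ) - m)) := by
      rw [Finset.mul_sum]
      refine Finset.sum_congr rfl fun m _ => ?_
      rw [← Real.exp_add]
      push_cast
      ring_nf
    have hexp : Real.exp (-y) * (1 + y) ≤ 1 := by
      calc Real.exp (-y) * (1 + y) ≤ Real.exp (-y) * Real.exp y := by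
            gcongr; linarith [Real.add_one_le_exp y]
        _ = 1 := by rw [← Real.exp_add]; simp
    have hbound : Real.exp (-y) * (1 + 1 / y) ≤ 1 / y := by
      rw [le_div_iff₀ hy]
      calc Real.exp (-y) * (1 + 1 / y) * y = Real.exp (-y) * (1 + y) := by field_simp; ring
        _ ≤ 1 := hexp
    have hmul := mul_le_mul_of_nonneg_left ih (Real.exp_pos (-y)).le
    rw [hstep, sub_self, mul_zero, Real.exp_zero]
    linarith

/-- If the decay rate `x` is small but dominates the logarithmic slope of `m ↦ m ^ (-a)`, the
weighted sum is at most `2 / x` times its last weight. -/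
lemma sum_exp_mul_rpow_neg_le {a x : ℝ} (ha : 0 ≤ a) (hx : 0 < x) (hx' : x ≤ 2 / 3) {t : ℕ}
    (ht : 2 ≤ t) (hslope : a * (Real.log t / (t - 1)) ≤ x / 4) :
    ∑ m ∈ Finset.Icc 1 t, Real.exp (-x * ((t : ℝ) - m)) * (m : ℝ) ^ (-a)
      ≤ 2 / x * (t : ℝ) ^ (-a) := by
  have ht' : (2 : ℝ) ≤ t := by exact_mod_cast ht
  have hterm : ∀ m ∈ Finset.Icc 1 t, Real.exp (-x * ((t : ℝ) - m)) * (m : ℝ) ^ (-a)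
      ≤ Real.exp (-(3 / 4 * x) * ((t : ℝ) - m)) * (t : ℝ) ^ (-a) := by
    intro m hm
    obtain ⟨hm1, hmt⟩ := Finset.mem_Icc.1 hm
    have hm1' : (1 : ℝ) ≤ m := by exact_mod_cast hm1
    have hmt' : (m : ℝ) ≤ t := by exact_mod_cast hmt
    rw [Real.rpow_def_of_pos (by linarith), Real.rpow_def_of_pos (by linarith),
      ← Real.exp_add, ← Real.exp_add, Real.exp_le_exp]
    have h1 := mul_le_mul_of_nonneg_left (log_sub_log_le_chord hm1' hmt' (by linarith)) ha
    have h2 := mul_le_mul_of_nonneg_right hslope (sub_nonneg.2 hmt')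
    linarith
  calc _ ≤ ∑ m ∈ Finset.Icc 1 t,
        Real.exp (-(3 / 4 * x) * ((t : ℝ) - m)) * (t : ℝ) ^ (-a) := Finset.sum_le_sum hterm
    _ = (∑ m ∈ Finset.Icc 1 t, Real.exp (-(3 / 4 * x) * ((t : ℝ) - m))) * (t : ℝ) ^ (-a) := by
        rw [Finset.sum_mul]
    _ ≤ (1 + 1 / (3 / 4 * x)) * (t : ℝ) ^ (-a) := by
        gcongr; exact sum_exp_neg_mul_sub_le (by positivity) t
    _ ≤ 2 / x * (t : ℝ) ^ (-a) := by
        gcongr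
        rw [le_div_iff₀ hx]
        have : (1 + 1 / (3 / 4 * x)) * x = x + 4 / 3 := by field_simp
        linarith

/-- Lemma B.1: geometric-weight summation bound. -/
theorem geometric_weight_sum_bound
    (C : ℝ) (hC : 0 < C) (δ : ℝ) (hδ0 : 0 < δ) (hδ1 : δ < 1)
    (a : ℝ) (ha0 : 0 ≤ a) (ha4 : a ≤ 4) :
    ∃ T : ℕ,
      (∀ t : ℕ, T ≤ t →
        (∑ m ∈ Finset.Icc 1 t,
            Real.exp (-C * ((t : ℝ) - (m : ℝ)) * (t : ℝ) ^ (-δ)) * (m : ℝ) ^ (-a))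
          ≤ (2 / C) * (t : ℝ) ^ (δ - a)) ∧
      (∀ Q : ℕ → ℕ → ℝ,
        (∀ t m : ℕ, 1 ≤ m → m ≤ t →
          0 < Q t m ∧ Q t m ≤ Real.exp (-C * ((t : ℝ) - (m : ℝ)) * (t : ℝ) ^ (-δ))) →
        ∀ t : ℕ, T ≤ t →
          (∑ m ∈ Finset.Icc 1 t, Q t m * (m : ℝ) ^ (-a)) ≤ (2 / C) * (t : ℝ) ^ (δ - a)) := by
  have hev : ∀ᶠ t : ℕ in Filter.atTop, 2 ≤ t ∧ C * (t : ℝ) ^ (-δ) ≤ 2 / 3 ∧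
      Real.log t ≤ C / 32 * (t : ℝ) ^ (1 - δ) := by
    have hsmall : Filter.Tendsto (fun t : ℝ => C * t ^ (-δ)) Filter.atTop (nhds 0) := by
      simpa using (tendsto_rpow_neg_atTop hδ0).const_mul C
    have hlog := (isLittleO_log_rpow_atTop (sub_pos.2 hδ1)).bound (show 0 < C / 32 by positivity)
    filter_upwards [Filter.eventually_ge_atTop 2,
      tendsto_natCast_atTop_atTop.eventually
        (hsmall.eventually_le_const (show (0 : ℝ) < 2 / 3 by norm_num)),
      tendsto_natCast_atTop_atTop.eventually hlog] with t h2 hs hl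
    refine ⟨h2, hs, (le_abs_self _).trans ?_⟩
    rwa [Real.norm_eq_abs, Real.norm_of_nonneg (by positivity)] at hl
  obtain ⟨T, hT⟩ := Filter.eventually_atTop.1 hev
  have hmain : ∀ t : ℕ, T ≤ t →
      (∑ m ∈ Finset.Icc 1 t,
          Real.exp (-C * ((t : ℝ) - (m : ℝ)) * (t : ℝ) ^ (-δ)) * (m : ℝ) ^ (-a))
        ≤ (2 / C) * (t : ℝ) ^ (δ - a) := by
    intro t hTt
    obtain ⟨h2, hs, hl⟩ := hT t hTt
    have ht : (2 : ℝ) ≤ t := by exact_mod_cast h2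
    have ht0 : (0 : ℝ) < t := by linarith
    have hslope : a * (Real.log t / (t - 1)) ≤ C * (t : ℝ) ^ (-δ) / 4 := by
      rw [← mul_div_assoc, div_le_iff₀ (by linarith)]
      have hpow : (t : ℝ) ^ (1 - δ) = t * (t : ℝ) ^ (-δ) := by
        rw [sub_eq_add_neg, Real.rpow_add ht0, Real.rpow_one]
      rw [hpow] at hl
      have ha := mul_le_mul_of_nonneg_right ha4 (Real.log_nonneg (by linarith : (1 : ℝ) ≤ t))
      have hx : 0 < C * (t : ℝ) ^ (-δ) := by positivity
      nlinarith [mul_nonneg hx.le (sub_nonneg.2 ht)]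
    calc _ = ∑ m ∈ Finset.Icc 1 t,
          Real.exp (-(C * (t : ℝ) ^ (-δ)) * ((t : ℝ) - m)) * (m : ℝ) ^ (-a) := by
          refine Finset.sum_congr rfl fun m _ => ?_
          ring_nf
      _ ≤ 2 / (C * (t : ℝ) ^ (-δ)) * (t : ℝ) ^ (-a) :=
          sum_exp_mul_rpow_neg_le ha0 (by positivity) hs h2 hslope
      _ = 2 / C * (t : ℝ) ^ (δ - a) := by
          rw [sub_eq_add_neg, Real.rpow_add ht0, Real.rpow_neg ht0.le δ]
          field_simp
  refine ⟨T, hmain, fun Q hQ t hTt => (Finset.sum_le_sum fun m hm => ?_).trans (hmain t hTt)⟩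
  obtain ⟨hm1, hmt⟩ := Finset.mem_Icc.1 hm
  exact mul_le_mul_of_nonneg_right (hQ t m hm1 hmt).2 (by positivity)
end

section
/- Strong monotonicity of the mean IV-TD field (Lemma on TD monotonicity). Suppose E[Z_i·η_j] = 0 and E[Z_i·η'_j] = 0 for all coordinates 1 ≤ i ≤ q and 1 ≤ j ≤ p, that E[(Γ*Z)(Γ*Z)ᵀ] = E[(Γ*Z')(Γ*Z')ᵀ] (stationarity of the instrument second moments), that γ ∈ [0,1), and that m > 0 satisfies vᵀ·E[(Γ*Z)(Γ*Z)ᵀ]·v ≥ m·‖v‖² for all v ∈ ℝ^p (m is a lower bound on the smallest eigenvalue of E[(Γ*Z)(Γ*Z)ᵀ]). Then for all θ, θ_π ∈ ℝ^p: (θ − θ_π)ᵀ·( Ḡ_TD(θ) − Ḡ_TD(θ_π) ) ≤ −(1−γ)·m·‖θ − θ_π‖². -/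
open MeasureTheory
open scoped RealInnerProductSpace

noncomputable section

/-- Matrix–vector multiplication on Euclidean spaces. -/
def mulVecE {p q : ℕ} (Γ : Matrix (Fin p) (Fin q) ℝ) (z : EuclideanSpace ℝ (Fin q)) :
    EuclideanSpace ℝ (Fin p) :=
  (EuclideanSpace.equiv (Fin p) ℝ).symm (Γ.mulVec (EuclideanSpace.equiv (Fin q) ℝ z))

/-- The Frobenius norm of a real matrix. -/
def frob {p q : ℕ} (Γ : Matrix (Fin p) (Fin q) ℝ) : ℝ :=
  Real.sqrt (∑ i, ∑ j, (Γ i j) ^ 2)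


/-- The mean IV-TD field `Ḡ_TD(θ) = E[(R + γ·X'ᵀθ − Xᵀθ)·Γ*Z]`, where
`X = Γ*Z + η` and `X' = Γ*Z' + η'`. -/
def GTDbar {p q : ℕ} {Ω : Type*} [MeasurableSpace Ω] (P : Measure Ω)
    (Γstar : Matrix (Fin p) (Fin q) ℝ) (γ : ℝ)
    (Z Z' : Ω → EuclideanSpace ℝ (Fin q)) (η η' : Ω → EuclideanSpace ℝ (Fin p))
    (R : Ω → ℝ) (θ : EuclideanSpace ℝ (Fin p)) : EuclideanSpace ℝ (Fin p) :=
  ∫ ω, (R ω + γ * ⟪mulVecE Γstar (Z' ω) + η' ω, θ⟫ -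
      ⟪mulVecE Γstar (Z ω) + η ω, θ⟫) • mulVecE Γstar (Z ω) ∂P

/-- `mulVecE Γ` as a continuous linear map. -/
def mulVecCLM {p q : ℕ} (Γ : Matrix (Fin p) (Fin q) ℝ) :
    EuclideanSpace ℝ (Fin q) →L[ℝ] EuclideanSpace ℝ (Fin p) :=
  LinearMap.toContinuousLinearMap (Matrix.toEuclideanLin Γ)

theorem mulVecE_eq_mulVecCLM {p q : ℕ} (Γ : Matrix (Fin p) (Fin q) ℝ)
    (z : EuclideanSpace ℝ (Fin q)) : mulVecE Γ z = mulVecCLM Γ z := rfl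

section Moments

variable {Ω : Type*} [MeasurableSpace Ω] {P : Measure Ω}

theorem integrable_inner_mul_inner {E F : Type*}
    [NormedAddCommGroup E] [InnerProductSpace ℝ E] [NormedAddCommGroup F] [InnerProductSpace ℝ F]
    {U : Ω → E} {V : Ω → F} (hU : AEStronglyMeasurable U P) (hV : AEStronglyMeasurable V P)
    (h : Integrable (fun ω => ‖U ω‖ * ‖V ω‖) P) (u : E) (v : F) :
    Integrable (fun ω => ⟪U ω, u⟫ * ⟪V ω, v⟫) P := by
  refine (h.mul_const (‖u‖ * ‖v‖)).mono'
    ((hU.inner aestronglyMeasurable_const).mul (hV.inner aestronglyMeasurable_const))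
    (.of_forall fun ω => ?_)
  calc ‖⟪U ω, u⟫ * ⟪V ω, v⟫‖ ≤ (‖U ω‖ * ‖u‖) * (‖V ω‖ * ‖v‖) := by
        rw [norm_mul]
        gcongr <;> exact norm_inner_le_norm _ _
    _ = ‖U ω‖ * ‖V ω‖ * (‖u‖ * ‖v‖) := by ring

theorem integrable_inner_smul {E F : Type*}
    [NormedAddCommGroup E] [InnerProductSpace ℝ E] [NormedAddCommGroup F] [NormedSpace ℝ F]
    {U : Ω → E} {V : Ω → F} (hU : AEStronglyMeasurable U P) (hV : AEStronglyMeasurable V P)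
    (h : Integrable (fun ω => ‖U ω‖ * ‖V ω‖) P) (u : E) :
    Integrable (fun ω => ⟪U ω, u⟫ • V ω) P := by
  refine (h.mul_const ‖u‖).mono' ((hU.inner aestronglyMeasurable_const).smul hV)
    (.of_forall fun ω => ?_)
  calc ‖⟪U ω, u⟫ • V ω‖ ≤ (‖U ω‖ * ‖u‖) * ‖V ω‖ := by
        rw [norm_smul]
        gcongr
        exact norm_inner_le_norm _ _
    _ = ‖U ω‖ * ‖V ω‖ * ‖u‖ := by ring

theorem integrable_norm_mul_norm_clm {E F G : Type*} [NormedAddCommGroup E]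
    [NormedAddCommGroup F] [NormedSpace ℝ F] [NormedAddCommGroup G] [NormedSpace ℝ G]
    {U : Ω → E} {V : Ω → F} (hU : AEStronglyMeasurable U P) (hV : AEStronglyMeasurable V P)
    (h : Integrable (fun ω => ‖U ω‖ * ‖V ω‖) P) (L : F →L[ℝ] G) :
    Integrable (fun ω => ‖U ω‖ * ‖L (V ω)‖) P := by
  refine (h.const_mul ‖L‖).mono'
    (hU.norm.mul (L.continuous.comp_aestronglyMeasurable hV).norm) (.of_forall fun ω => ?_)
  calc ‖‖U ω‖ * ‖L (V ω)‖‖ = ‖U ω‖ * ‖L (V ω)‖ := Real.norm_of_nonneg (by positivity)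
    _ ≤ ‖U ω‖ * (‖L‖ * ‖V ω‖) := by gcongr; exact L.le_opNorm _
    _ = ‖L‖ * (‖U ω‖ * ‖V ω‖) := by ring

theorem integrable_norm_mul_norm {E F : Type*} [NormedAddCommGroup E] [NormedAddCommGroup F]
    {U : Ω → E} {V : Ω → F} (hU : AEStronglyMeasurable U P) (hV : AEStronglyMeasurable V P)
    (hU2 : Integrable (fun ω => ‖U ω‖ ^ 2) P) (hV2 : Integrable (fun ω => ‖V ω‖ ^ 2) P) :
    Integrable (fun ω => ‖U ω‖ * ‖V ω‖) P := by
  refine (hU2.add hV2).mono' (hU.norm.mul hV.norm) (.of_forall fun ω => ?_)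
  rw [Real.norm_of_nonneg (by positivity), Pi.add_apply]
  nlinarith [sq_nonneg (‖U ω‖ - ‖V ω‖), sq_nonneg ‖U ω‖, sq_nonneg ‖V ω‖]

/-- Expansion of a mixed second moment of two linear forms in coordinates. -/
theorem integral_inner_mul_inner_eq_sum {p q : ℕ} {U : Ω → EuclideanSpace ℝ (Fin p)}
    {V : Ω → EuclideanSpace ℝ (Fin q)}
    (hU : AEStronglyMeasurable U P) (hV : AEStronglyMeasurable V P)
    (h : Integrable (fun ω => ‖U ω‖ * ‖V ω‖) P)
    (u : EuclideanSpace ℝ (Fin p)) (v : EuclideanSpace ℝ (Fin q)) :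
    ∫ ω, ⟪U ω, u⟫ * ⟪V ω, v⟫ ∂P = ∑ i, ∑ j, u i * v j * ∫ ω, U ω i * V ω j ∂P := by
  have hij (i : Fin p) (j : Fin q) : Integrable (fun ω => U ω i * V ω j) P := by
    simpa [EuclideanSpace.inner_single_right] using integrable_inner_mul_inner hU hV h
      (EuclideanSpace.single i (1 : ℝ)) (EuclideanSpace.single j (1 : ℝ))
  have hexp (ω : Ω) : ⟪U ω, u⟫ * ⟪V ω, v⟫ = ∑ i, ∑ j, u i * v j * (U ω i * V ω j) := by
    simp only [PiLp.inner_apply, Finset.sum_mul_sum]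
    refine Finset.sum_congr rfl fun i _ => Finset.sum_congr rfl fun j _ => ?_
    simp only [RCLike.inner_apply, conj_trivial]
    ring
  simp only [hexp]
  rw [integral_finsetSum _ fun i _ => integrable_finsetSum _ fun j _ => (hij i j).const_mul _]
  refine Finset.sum_congr rfl fun i _ => ?_
  rw [integral_finsetSum _ fun j _ => (hij i j).const_mul _]
  exact Finset.sum_congr rfl fun j _ => integral_const_mul _ _

/-- The quadratic form of the second-moment matrix of `W` is `v ↦ E[⟪W, v⟫ ^ 2]`. -/
theorem inner_mulVecE_secondMoment {p : ℕ} {W : Ω → EuclideanSpace ℝ (Fin p)}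
    (hW : AEStronglyMeasurable W P) (h : Integrable (fun ω => ‖W ω‖ * ‖W ω‖) P)
    (v : EuclideanSpace ℝ (Fin p)) :
    ⟪v, mulVecE (Matrix.of fun i j : Fin p => ∫ ω, W ω i * W ω j ∂P) v⟫ =
      ∫ ω, ⟪W ω, v⟫ * ⟪W ω, v⟫ ∂P := by
  rw [integral_inner_mul_inner_eq_sum hW hW h]
  simp only [mulVecE, PiLp.inner_apply, RCLike.inner_apply, conj_trivial]
  refine Finset.sum_congr rfl fun i _ => ?_
  change (∑ j, (∫ ω, W ω i * W ω j ∂P) * v j) * v i = _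
  rw [Finset.sum_mul]
  exact Finset.sum_congr rfl fun j _ => by ring

/-- A residual uncorrelated with `Z` is uncorrelated with every linear image of `Z`. -/
theorem integral_inner_mul_inner_clm_eq_zero {p q r : ℕ} {η : Ω → EuclideanSpace ℝ (Fin p)}
    {Z : Ω → EuclideanSpace ℝ (Fin q)}
    (hη : AEStronglyMeasurable η P) (hZ : AEStronglyMeasurable Z P)
    (h : Integrable (fun ω => ‖η ω‖ * ‖Z ω‖) P)
    (h0 : ∀ (i : Fin q) (j : Fin p), (∫ ω, Z ω i * η ω j ∂P) = 0)
    (L : EuclideanSpace ℝ (Fin q) →L[ℝ] EuclideanSpace ℝ (Fin r))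
    (u : EuclideanSpace ℝ (Fin p)) (v : EuclideanSpace ℝ (Fin r)) :
    ∫ ω, ⟪η ω, u⟫ * ⟪L (Z ω), v⟫ ∂P = 0 := by
  simp only [← ContinuousLinearMap.adjoint_inner_right]
  rw [integral_inner_mul_inner_eq_sum hη hZ h]
  refine Finset.sum_eq_zero fun j _ => Finset.sum_eq_zero fun i _ => ?_
  simp only [mul_comm (η _ j), h0, mul_zero]

end Moments

/-- Strong monotonicity of the mean IV-TD field. -/
theorem GTDbar_strong_monotonicity
    {p q : ℕ} {Ω : Type*} [MeasurableSpace Ω] (P : Measure Ω) [IsProbabilityMeasure P]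
    (Γstar : Matrix (Fin p) (Fin q) ℝ) (γ : ℝ) (hγ0 : 0 ≤ γ) (hγ1 : γ < 1)
    (Z Z' : Ω → EuclideanSpace ℝ (Fin q)) (η η' : Ω → EuclideanSpace ℝ (Fin p))
    (R : Ω → ℝ)
    (hZmeas : Measurable Z) (hZ'meas : Measurable Z')
    (hηmeas : Measurable η) (hη'meas : Measurable η') (hRmeas : Measurable R)
    (hZ2 : Integrable (fun ω => ‖Z ω‖ ^ 2) P)
    (hZ'2 : Integrable (fun ω => ‖Z' ω‖ ^ 2) P)
    (hηZ : Integrable (fun ω => ‖η ω‖ * ‖Z ω‖) P)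
    (hη'Z : Integrable (fun ω => ‖η' ω‖ * ‖Z ω‖) P)
    (hRZ : Integrable (fun ω => |R ω| * ‖Z ω‖) P)
    (hZη : ∀ (i : Fin q) (j : Fin p), (∫ ω, Z ω i * η ω j ∂P) = 0)
    (hZη' : ∀ (i : Fin q) (j : Fin p), (∫ ω, Z ω i * η' ω j ∂P) = 0)
    -- stationarity of the instrument second moments
    (hstat : (Matrix.of fun i j : Fin p =>
        ∫ ω, mulVecE Γstar (Z ω) i * mulVecE Γstar (Z ω) j ∂P) =
      (Matrix.of fun i j : Fin p =>
        ∫ ω, mulVecE Γstar (Z' ω) i * mulVecE Γstar (Z' ω) j ∂P))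
    (m : ℝ) (hm : 0 < m)
    (heig : ∀ v : EuclideanSpace ℝ (Fin p),
      m * ‖v‖ ^ 2 ≤ ⟪v, mulVecE (Matrix.of fun i j : Fin p =>
        ∫ ω, mulVecE Γstar (Z ω) i * mulVecE Γstar (Z ω) j ∂P) v⟫) :
    ∀ θ θpi : EuclideanSpace ℝ (Fin p),
      ⟪θ - θpi, GTDbar P Γstar γ Z Z' η η' R θ - GTDbar P Γstar γ Z Z' η η' R θpi⟫
        ≤ -(1 - γ) * m * ‖θ - θpi‖ ^ 2 := by
  intro θ θpi
  set L := mulVecCLM Γstar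
  simp only [GTDbar, mulVecE_eq_mulVecCLM Γstar] at hstat heig ⊢
  have mZ : AEStronglyMeasurable Z P := hZmeas.aestronglyMeasurable
  have mZ' : AEStronglyMeasurable Z' P := hZ'meas.aestronglyMeasurable
  have mη : AEStronglyMeasurable η P := hηmeas.aestronglyMeasurable
  have mη' : AEStronglyMeasurable η' P := hη'meas.aestronglyMeasurable
  have mW : AEStronglyMeasurable (fun ω => L (Z ω)) P :=
    L.continuous.comp_aestronglyMeasurable mZ
  have mW' : AEStronglyMeasurable (fun ω => L (Z' ω)) P :=
    L.continuous.comp_aestronglyMeasurable mZ'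
  have iWW : Integrable (fun ω => ‖L (Z ω)‖ * ‖L (Z ω)‖) P :=
    integrable_norm_mul_norm_clm mW mZ (by
      simpa only [mul_comm] using integrable_norm_mul_norm_clm mZ mZ
        (integrable_norm_mul_norm mZ mZ hZ2 hZ2) L) L
  have iWW' : Integrable (fun ω => ‖L (Z' ω)‖ * ‖L (Z' ω)‖) P :=
    integrable_norm_mul_norm_clm mW' mZ' (by
      simpa only [mul_comm] using integrable_norm_mul_norm_clm mZ' mZ'
        (integrable_norm_mul_norm mZ' mZ' hZ'2 hZ'2) L) L
  have iW'W : Integrable (fun ω => ‖L (Z' ω)‖ * ‖L (Z ω)‖) P :=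
    integrable_norm_mul_norm mW' mW (by simpa only [sq] using iWW') (by simpa only [sq] using iWW)
  have iηW := integrable_norm_mul_norm_clm mη mZ hηZ L
  have iη'W := integrable_norm_mul_norm_clm mη' mZ hη'Z L
  have iRW : Integrable (fun ω => R ω • L (Z ω)) P := by
    simpa using integrable_inner_smul hRmeas.aestronglyMeasurable mW
      (integrable_norm_mul_norm_clm hRmeas.aestronglyMeasurable mZ hRZ L) (1 : ℝ)
  have hfield (t : EuclideanSpace ℝ (Fin p)) : Integrable (fun ω =>
      (R ω + γ * ⟪L (Z' ω) + η' ω, t⟫ - ⟪L (Z ω) + η ω, t⟫) • L (Z ω)) P := by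
    refine ((iRW.add (((integrable_inner_smul mW' mW iW'W t).add
      (integrable_inner_smul mη' mW iη'W t)).smul γ)).sub
      ((integrable_inner_smul mW mW iWW t).add (integrable_inner_smul mη mW iηW t))).congr
      (.of_forall fun ω => ?_)
    simp only [Pi.add_apply, Pi.sub_apply, Pi.smul_apply, inner_add_left]
    module
  set u := θ - θpi with hu
  have jW := integrable_inner_mul_inner mW mW iWW u u
  have jW' := integrable_inner_mul_inner mW' mW' iWW' u u
  have jW'W := integrable_inner_mul_inner mW' mW iW'W u u
  have jη := integrable_inner_mul_inner mη mW iηW u u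
  have jη' := integrable_inner_mul_inner mη' mW iη'W u u
  have hη0 := integral_inner_mul_inner_clm_eq_zero mη mZ hηZ hZη L u u
  have hη'0 := integral_inner_mul_inner_clm_eq_zero mη' mZ hη'Z hZη' L u u
  have hdiff : ⟪u, (∫ ω, (R ω + γ * ⟪L (Z' ω) + η' ω, θ⟫ - ⟪L (Z ω) + η ω, θ⟫) • L (Z ω) ∂P) -
      ∫ ω, (R ω + γ * ⟪L (Z' ω) + η' ω, θpi⟫ - ⟪L (Z ω) + η ω, θpi⟫) • L (Z ω) ∂P⟫ =
      γ * ∫ ω, ⟪L (Z' ω), u⟫ * ⟪L (Z ω), u⟫ ∂P - ∫ ω, ⟪L (Z ω), u⟫ * ⟪L (Z ω), u⟫ ∂P := by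
    rw [← integral_sub' (hfield θ) (hfield θpi),
      ← integral_inner ((hfield θ).sub (hfield θpi))]
    have hpt (ω : Ω) : ⟪u, (R ω + γ * ⟪L (Z' ω) + η' ω, θ⟫ - ⟪L (Z ω) + η ω, θ⟫) • L (Z ω) -
        (R ω + γ * ⟪L (Z' ω) + η' ω, θpi⟫ - ⟪L (Z ω) + η ω, θpi⟫) • L (Z ω)⟫ =
        γ * (⟪L (Z' ω), u⟫ * ⟪L (Z ω), u⟫ + ⟪η' ω, u⟫ * ⟪L (Z ω), u⟫) -
          (⟪L (Z ω), u⟫ * ⟪L (Z ω), u⟫ + ⟪η ω, u⟫ * ⟪L (Z ω), u⟫) := by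
      rw [← sub_smul, inner_smul_right, real_inner_comm (L (Z ω)) u]
      simp only [hu, inner_add_left, inner_sub_right]
      ring
    simp only [Pi.sub_apply, hpt]
    rw [integral_sub ((jW'W.fun_add jη').const_mul γ) (jW.fun_add jη), integral_const_mul,
      integral_add jW'W jη', integral_add jW jη, hη0, hη'0, add_zero, add_zero]
  have hmom : ∫ ω, ⟪L (Z' ω), u⟫ * ⟪L (Z' ω), u⟫ ∂P =
      ∫ ω, ⟪L (Z ω), u⟫ * ⟪L (Z ω), u⟫ ∂P := by
    rw [← inner_mulVecE_secondMoment mW' iWW', ← inner_mulVecE_secondMoment mW iWW, hstat]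
  have hcross : ∫ ω, ⟪L (Z' ω), u⟫ * ⟪L (Z ω), u⟫ ∂P ≤
      ∫ ω, ⟪L (Z ω), u⟫ * ⟪L (Z ω), u⟫ ∂P := by
    have hle := integral_mono (jW'W.const_mul 2) (jW'.add jW) fun ω => by
      simp only [Pi.add_apply]
      nlinarith [sq_nonneg (⟪L (Z' ω), u⟫ - ⟪L (Z ω), u⟫)]
    rw [integral_const_mul, integral_add' jW' jW, hmom] at hle
    linarith
  have hlow := heig u
  rw [inner_mulVecE_secondMoment mW iWW] at hlow
  rw [hdiff]
  nlinarith [mul_le_mul_of_nonneg_left hcross hγ0,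
    mul_le_mul_of_nonneg_left hlow (sub_nonneg.2 hγ1.le)]

end
end
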